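/- arXiv:1108.5053 — 3 statements merged into one kernel-verified Lean document; each statement's English description precedes it below -/
import Mathlib

section
/- Let σ and ρ be primitive invertible substitutions on the two-letter alphabet 𝒜 = {a,b}. Then X_σ = X_ρ if and only if σ^k ~ ρ^m for some integers k, m ≥ 1. -/
open scoped Matrix

/-- The two-letter alphabet `𝒜 = {a, b}`; the letter `a` is `0` and the letter `b` is `1`. -/
abbrev A2 := Fin 2

/-- A substitution on the two-letter alphabet, given by the images of the two letters.
(The nonerasing condition is stated separately as `TwoSubst.NonErasing`.) -/
abbrev Subst := A2 → List A2

namespace TwoSubst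

/-- A substitution is non-erasing if the images of the letters are nonempty words. -/
def NonErasing (σ : Subst) : Prop := ∀ i : A2, σ i ≠ []

/-- The extension of a substitution to finite words (the morphism of the free monoid). -/
def apply (σ : Subst) (w : List A2) : List A2 := w.flatMap σ

/-- The `n`-th power `σ^n` of a substitution (as a substitution). -/
def substPow (σ : Subst) (n : ℕ) : Subst := fun i => (apply σ)^[n] [i]

/-- Composition of substitutions: `(σ ∘ τ)(i) = σ(τ(i))`. -/
def comp (σ τ : Subst) : Subst := fun i => apply σ (τ i)

/-- The substitution matrix `M_σ`: entry `(i, j)` is the number of occurrences of the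
letter `i` in `σ(j)`. -/
def M (σ : Subst) : Matrix (Fin 2) (Fin 2) ℤ := fun i j => ((σ j).count i : ℤ)

/-- A substitution is primitive if some power of its substitution matrix has all
entries positive. -/
def Primitive (σ : Subst) : Prop := ∃ n : ℕ, 0 < n ∧ ∀ i j, 0 < (M σ ^ n) i j

/-- A finite word, regarded as an element of the free group `F₂`. -/
def toFG (w : List A2) : FreeGroup A2 := (w.map FreeGroup.of).prod

/-- The endomorphism of the free group `F₂` induced by a substitution. -/
def endo (σ : Subst) : Monoid.End (FreeGroup A2) := FreeGroup.lift fun i => toFG (σ i)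

/-- A substitution is invertible if its extension to the free group `F₂` is an
automorphism of `F₂`. -/
def IsInvertible (σ : Subst) : Prop := Function.Bijective (endo σ)

/-- Two substitutions are conjugate, `σ ~ ρ`, if `σ = γ_w ∘ ρ` as endomorphisms of `F₂`
for some `w ∈ F₂`, where `γ_w x = w * x * w⁻¹`. -/
def Conj (σ ρ : Subst) : Prop := ∃ w : FreeGroup A2, ∀ x, endo σ x = w * endo ρ x * w⁻¹

/-- `w` is a (finite) factor of the bi-infinite word `u : ℤ → A2`. -/
def IsFactor (w : List A2) (u : ℤ → A2) : Prop :=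
  ∃ k : ℤ, w = (List.range w.length).map fun i => u (k + i)

/-- The hull `X_σ`: the set of bi-infinite words all of whose finite factors appear as
factors of `σ^n(a)` or `σ^n(b)` for some `n ∈ ℕ`. -/
def Hull (σ : Subst) : Set (ℤ → A2) :=
  { u | ∀ w : List A2, IsFactor w u → ∃ (n : ℕ) (x : A2), w <:+: substPow σ n x }

/-- The substitution `E : a ↦ b, b ↦ a`. -/
def Esub : Subst := ![[1], [0]]

/-- The substitution `L : a ↦ a, b ↦ ab`. -/
def Lsub : Subst := ![[0], [0, 1]]

/-- The composition `L^{a₁} ∘ E ∘ L^{a₂} ∘ E ∘ ⋯ ∘ E ∘ L^{a_m}` encoded by the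
nonempty list of exponents `a₁ :: [a₂, …, a_m]`. -/
def chain : ℕ → List ℕ → Subst
  | a, [] => substPow Lsub a
  | a, b :: rest => comp (substPow Lsub a) (comp Esub (chain b rest))

/-- The letter-exchange map `a ↦ b, b ↦ a` on letters. -/
def swapA : A2 → A2 := fun i => if i = 0 then 1 else 0

/-- The substitution matrix with real entries. -/
noncomputable def Mreal (σ : Subst) : Matrix (Fin 2) (Fin 2) ℝ := (M σ).map fun z => (z : ℝ)

/-- `lam` is the inflation factor (Perron–Frobenius eigenvalue) of `σ`: it is an
eigenvalue of `M_σ` admitting a positive eigenvector. -/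
def IsInflation (σ : Subst) (lam : ℝ) : Prop :=
  ∃ v : Fin 2 → ℝ, (∀ i, 0 < v i) ∧ (Mreal σ).mulVec v = lam • v

/-- `α` is the frequency of `σ`: `α ∈ (0,1)` and `(1-α, α)` is an eigenvector of `M_σ`
for an eigenvalue with positive eigenvector (necessarily the Perron-Frobenius
eigenvalue, i.e. the inflation factor, when `σ` is primitive). -/
def IsFreq (σ : Subst) (α : ℝ) : Prop :=
  0 < α ∧ α < 1 ∧ ∃ lam : ℝ, (Mreal σ).mulVec ![1 - α, α] = lam • ![1 - α, α]

/-- The automorphism `τ_a : a ↦ a⁻¹, b ↦ b` of the free group `F₂`. -/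
def tauA : Monoid.End (FreeGroup A2) :=
  FreeGroup.lift fun i : A2 => if i = 0 then (FreeGroup.of (0 : A2))⁻¹ else FreeGroup.of 1

/-- `ρ` is the reciprocal substitution `σ̄ = τ_a ∘ σ⁻¹ ∘ τ_a⁻¹` of `σ`, where
`φ` is the inverse automorphism `σ⁻¹` (note `τ_a⁻¹ = τ_a`). -/
def IsReciprocal (σ ρ : Subst) (φ : Monoid.End (FreeGroup A2)) : Prop :=
  (∀ x, φ (endo σ x) = x) ∧ (∀ x, endo σ (φ x) = x) ∧
    NonErasing ρ ∧ ∀ x, endo ρ x = tauA (φ (tauA x))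

/-- `σ` is a selfdual substitution (relative to its reciprocal `ρ = σ̄`):
`σ ~ σ̄` or `σ ~ E ∘ σ̄ ∘ E`. -/
def SelfDual (σ ρ : Subst) : Prop :=
  Conj σ ρ ∨ Conj σ (comp Esub (comp ρ Esub))

/-! ### Strands and dual maps -/

/-- Integer vectors in the plane. -/
abbrev V2 := Fin 2 → ℤ

/-- The abelianisation map `A : 𝒜* → ℤ²`, counting occurrences of each letter. -/
def Avec (w : List A2) : V2 := fun i => (w.count i : ℤ)

/-- The space `𝒢` (and its dual `𝒢*`): formal finite real linear combinations of the
basis elements `(W, i)` (resp. `(W, i*)`), `W ∈ ℤ²`, `i ∈ 𝒜`. -/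
abbrev Gspace := (V2 × A2) →₀ ℝ

/-- The image of the basis element `(W, i)` under `E₁(σ)`. -/
noncomputable def E1Basis (σ : Subst) (p : V2 × A2) : Gspace :=
  ∑ k ∈ Finset.range (σ p.2).length,
    Finsupp.single ((M σ).mulVec p.1 + Avec ((σ p.2).take k), (σ p.2).getD k p.2) (1 : ℝ)

/-- The one-dimensional extension `E₁(σ)`, as a linear map on `𝒢`. -/
noncomputable def E1 (σ : Subst) : Gspace →ₗ[ℝ] Gspace :=
  Finsupp.lift Gspace ℝ (V2 × A2) (E1Basis σ)

/-- The image of the basis element `(W, i*)` under the dual map `E₁*(σ)`: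
`E₁*(σ)(W, i*) = Σ_{j,k : σ(j)_k = i} (M_σ⁻¹·(W + A(σ(j)_{k+1}⋯σ(j)_{|σ(j)|})), j*)`. -/
noncomputable def E1starBasis (σ : Subst) (p : V2 × A2) : Gspace :=
  ∑ j : A2, ∑ k ∈ Finset.range (σ j).length,
    if (σ j).getD k j = p.2 then
      Finsupp.single ((M σ)⁻¹.mulVec (p.1 + Avec ((σ j).drop (k + 1))), j) (1 : ℝ)
    else 0

/-- The dual map `E₁*(σ)`, as a linear map on `𝒢*`. -/
noncomputable def E1star (σ : Subst) : Gspace →ₗ[ℝ] Gspace :=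
  Finsupp.lift Gspace ℝ (V2 × A2) (E1starBasis σ)

/-- The basis vector `e_a = (1,0)`. -/
def ea : V2 := ![1, 0]

/-- The basis vector `e_b = (0,1)`. -/
def eb : V2 := ![0, 1]

/-- `γ(0), …, γ(n)` is a finite dual strand: each step is `e_a` or `-e_b`. -/
def IsDualStrand (n : ℕ) (γ : ℕ → V2) : Prop :=
  ∀ k < n, γ (k + 1) - γ k = ea ∨ γ (k + 1) - γ k = -eb

/-- The element of `𝒢*` associated with a finite dual strand `γ(0), …, γ(n)`:
the sum of `(γ(k), b*)` over the `e_a`-steps and `(γ(k+1), a*)` over the `-e_b`-steps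
(the letter `a` is `0`, the letter `b` is `1`). -/
noncomputable def strandElem (n : ℕ) (γ : ℕ → V2) : Gspace :=
  ∑ k ∈ Finset.range n,
    if γ (k + 1) - γ k = ea then Finsupp.single (γ k, (1 : A2)) (1 : ℝ)
    else Finsupp.single (γ (k + 1), (0 : A2)) (1 : ℝ)

/-! ### Endomorphisms of the free group -/

/-- The exponent-sum homomorphism of the generator `i` on `F₂`. -/
def expSum (i : A2) : FreeGroup A2 →* Multiplicative ℤ :=
  FreeGroup.lift fun j : A2 => Multiplicative.ofAdd (if j = i then (1 : ℤ) else 0)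

/-- The abelianised matrix of an endomorphism of `F₂`: entry `(i,j)` is the exponent
sum of the generator `i` in the image of the generator `j`. -/
def abelMatrix (σ : Monoid.End (FreeGroup A2)) : Matrix (Fin 2) (Fin 2) ℤ :=
  fun i j => Multiplicative.toAdd (expSum i (σ (FreeGroup.of j)))

/-- `wprod ρ w k = w · ρ(w) · ρ²(w) ⋯ ρ^{k−1}(w)`. -/
def wprod (ρ : Monoid.End (FreeGroup A2)) (w : FreeGroup A2) : ℕ → FreeGroup A2
  | 0 => 1
  | k + 1 => wprod ρ w k * (ρ ^ k) w

end TwoSubst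

namespace TwoSubst

/-! ### Basic facts -/

theorem apply_nil (σ : Subst) : apply σ [] = [] := rfl

theorem apply_append (σ : Subst) (u v : List A2) :
    apply σ (u ++ v) = apply σ u ++ apply σ v := by simp [apply]

theorem apply_cons (σ : Subst) (x : A2) (v : List A2) :
    apply σ (x :: v) = σ x ++ apply σ v := by simp [apply]

theorem apply_single (σ : Subst) (x : A2) : apply σ [x] = σ x := by simp [apply]

theorem apply_comp (σ τ : Subst) (w : List A2) :
    apply (comp σ τ) w = apply σ (apply τ w) := by
  induction w with
  | nil => rfl
  | cons x w ih => rw [apply_cons, apply_cons, apply_append, ih]; rfl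

theorem comp_assoc (σ τ υ : Subst) : comp (comp σ τ) υ = comp σ (comp τ υ) := by
  funext x; exact apply_comp σ τ (υ x)

/-- identity substitution -/
def idS : Subst := fun i => [i]

theorem apply_idS (w : List A2) : apply idS w = w := by
  induction w with
  | nil => rfl
  | cons x w ih => rw [apply_cons, ih]; rfl

theorem comp_idS (σ : Subst) : comp σ idS = σ := by
  funext x; exact apply_single σ x

theorem idS_comp (σ : Subst) : comp idS σ = σ := by
  funext x; exact apply_idS _

theorem substPow_zero (σ : Subst) : substPow σ 0 = idS := rfl

theorem apply_substPow (σ : Subst) (n : ℕ) (w : List A2) :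
    apply (substPow σ n) w = (apply σ)^[n] w := by
  induction w with
  | nil =>
    have : ∀ n, (apply σ)^[n] [] = [] := by
      intro n
      induction n with
      | zero => rfl
      | succ n ih => rw [Function.iterate_succ_apply', ih]; rfl
    rw [this]; rfl
  | cons x w ih =>
    have : ∀ n u v, (apply σ)^[n] (u ++ v) = (apply σ)^[n] u ++ (apply σ)^[n] v := by
      intro n
      induction n with
      | zero => intros; rfl
      | succ n ih => intro u v; simp only [Function.iterate_succ_apply, apply_append, ih]
    rw [apply_cons, ih, ← List.singleton_append (l := w), this]; rfl

theorem substPow_add (σ : Subst) (m n : ℕ) :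
    substPow σ (m + n) = comp (substPow σ m) (substPow σ n) := by
  funext x
  simp only [comp, apply_substPow]
  simp only [substPow, Function.iterate_add_apply]

theorem substPow_one (σ : Subst) : substPow σ 1 = σ := by
  funext x; simp [substPow, apply_single]

theorem substPow_succ (σ : Subst) (n : ℕ) : substPow σ (n + 1) = comp (substPow σ n) σ := by
  rw [substPow_add, substPow_one]

theorem substPow_succ' (σ : Subst) (n : ℕ) : substPow σ (n + 1) = comp σ (substPow σ n) := by
  rw [add_comm, substPow_add, substPow_one]

theorem substPow_mul (σ : Subst) (m n : ℕ) :
    substPow σ (m * n) = substPow (substPow σ m) n := by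
  induction n with
  | zero => rfl
  | succ n ih => rw [Nat.mul_succ, substPow_add, ih, substPow_succ]

theorem apply_infix (σ : Subst) {u v : List A2} (h : u <:+: v) : apply σ u <:+: apply σ v := by
  obtain ⟨p, q, rfl⟩ := h
  exact ⟨apply σ p, apply σ q, by simp [apply_append]⟩

theorem infix_of_mem {x : A2} {l : List A2} (h : x ∈ l) : [x] <:+: l := by
  obtain ⟨p, q, rfl⟩ := List.append_of_mem h
  exact ⟨p, q, by simp⟩

theorem mem_apply {σ : Subst} {x : A2} {w : List A2} :
    x ∈ apply σ w ↔ ∃ y ∈ w, x ∈ σ y := by simp [apply]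

/-! ### Language, primitivity -/

/-- The language of a substitution. -/
def Lang (σ : Subst) : Set (List A2) := {w | ∃ (n : ℕ) (x : A2), w <:+: substPow σ n x}

/-- Combinatorial primitivity. -/
def Prim (σ : Subst) : Prop := ∃ n : ℕ, 0 < n ∧ ∀ x y, x ∈ substPow σ n y

theorem Prim.ne {σ : Subst} (h : Prim σ) (x : A2) : σ x ≠ [] := by
  obtain ⟨n, hn, h⟩ := h
  intro h0
  have h1 := h x x
  obtain ⟨m, rfl⟩ : ∃ m, n = m + 1 := ⟨n - 1, by omega⟩
  rw [substPow_succ] at h1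
  simp [comp, h0, apply_nil] at h1

theorem Prim.surj1 {σ : Subst} (h : Prim σ) (x : A2) : ∃ y, x ∈ σ y := by
  obtain ⟨n, hn, h⟩ := h
  have h1 := h x x
  obtain ⟨m, rfl⟩ : ∃ m, n = m + 1 := ⟨n - 1, by omega⟩
  rw [substPow_succ', comp, mem_apply] at h1
  obtain ⟨y, _, hy⟩ := h1
  exact ⟨y, hy⟩

theorem Prim.surj {σ : Subst} (h : Prim σ) (n : ℕ) (x : A2) : ∃ y, x ∈ substPow σ n y := by
  induction n generalizing x with
  | zero => exact ⟨x, by simp [substPow]⟩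
  | succ n ih =>
    obtain ⟨y, hy⟩ := ih x
    obtain ⟨z, hz⟩ := h.surj1 y
    exact ⟨z, by rw [substPow_succ, comp, mem_apply]; exact ⟨y, hz, hy⟩⟩

theorem length_le_apply {σ : Subst} (h : ∀ x, σ x ≠ []) (w : List A2) :
    w.length ≤ (apply σ w).length := by
  induction w with
  | nil => simp
  | cons x w ih =>
    rw [apply_cons, List.length_append, List.length_cons]
    have := List.length_pos_iff.2 (h x)
    omega

theorem ne_substPow {σ : Subst} (h : ∀ x, σ x ≠ []) (n : ℕ) (x : A2) : substPow σ n x ≠ [] := by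
  induction n generalizing x with
  | zero => simp [substPow]
  | succ n ih =>
    rw [substPow_succ]
    have := length_le_apply (fun x => ih x) (σ x)
    have h2 := List.length_pos_iff.2 (h x)
    intro h3
    simp only [comp] at h3
    rw [h3] at this
    simp at this
    exact h x this

theorem lang_infix {σ : Subst} {u v : List A2} (h : u <:+: v) (hv : v ∈ Lang σ) : u ∈ Lang σ := by
  obtain ⟨n, x, hx⟩ := hv
  exact ⟨n, x, h.trans hx⟩

theorem lang_apply_pow {σ : Subst} {v : List A2} (hv : v ∈ Lang σ) (m : ℕ) :
    apply (substPow σ m) v ∈ Lang σ := by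
  obtain ⟨n, x, hx⟩ := hv
  refine ⟨m + n, x, ?_⟩
  rw [substPow_add]
  exact apply_infix _ hx

theorem lang_single (σ : Subst) (x : A2) : [x] ∈ Lang σ := ⟨0, x, List.infix_refl _⟩

theorem lang_pow {σ : Subst} (h : Prim σ) {k : ℕ} (hk : 1 ≤ k) : Lang (substPow σ k) = Lang σ := by
  ext w
  constructor
  · rintro ⟨n, x, hx⟩
    exact ⟨k * n, x, by rwa [substPow_mul]⟩
  · rintro ⟨n, x, hx⟩
    obtain ⟨y, hy⟩ := h.surj (k * n - n) x
    refine ⟨n, y, ?_⟩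
    rw [← substPow_mul]
    have : k * n = n + (k * n - n) := by
      have : n ≤ k * n := Nat.le_mul_of_pos_left n hk
      omega
    rw [this, substPow_add]
    refine hx.trans ?_
    rw [← apply_single (substPow σ n) x]
    exact apply_infix _ (infix_of_mem hy)

theorem prim_pow {σ : Subst} (h : Prim σ) {k : ℕ} (hk : 1 ≤ k) : Prim (substPow σ k) := by
  obtain ⟨n, hn, h'⟩ := id h
  refine ⟨n, hn, fun x y => ?_⟩
  rw [← substPow_mul]
  have : k * n = n + (k * n - n) := by
    have : n ≤ k * n := Nat.le_mul_of_pos_left n hk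
    omega
  rw [this, substPow_add, comp, mem_apply]
  obtain ⟨z, hz⟩ := List.exists_mem_of_ne_nil _ (ne_substPow h.ne (k * n - n) y)
  exact ⟨z, hz, h' x z⟩

theorem two_le_of_all {l : List A2} (h : ∀ x, x ∈ l) : 2 ≤ l.length := by
  have h0 := h 0
  have h1 := h 1
  match l with
  | [] => simp at h0
  | [x] => exact absurd ((List.mem_singleton.1 h0).trans (List.mem_singleton.1 h1).symm) (by decide)
  | x :: y :: l => simp

/-- the language of a primitive substitution is extendable. -/
theorem lang_ext {σ : Subst} (h : Prim σ) {w : List A2} (hw : w ∈ Lang σ) :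
    ∃ x y, x :: (w ++ [y]) ∈ Lang σ := by
  obtain ⟨m, z, hz⟩ := hw
  obtain ⟨n, hn, h'⟩ := id h
  -- a word of length ≥ 3
  have hlen : ∀ u : List A2, 2 * u.length ≤ (apply (substPow σ n) u).length := by
    intro u
    induction u with
    | nil => simp
    | cons x u ih =>
      rw [apply_cons, List.length_append, List.length_cons]
      have := two_le_of_all (fun y => h' y x)
      omega
  have h4 : 4 ≤ (substPow σ (n + n) 0).length := by
    rw [substPow_add]
    have := hlen (substPow σ n 0)
    have := two_le_of_all (fun y => h' y 0)
    simp only [comp]; omega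
  obtain ⟨a, b, c, d, he⟩ : ∃ a b c d, substPow σ (n + n) 0 = a :: b :: c :: d := by
    match substPow σ (n + n) 0, h4 with
    | a :: b :: c :: d, _ => exact ⟨a, b, c, d, rfl⟩
  obtain ⟨p, q, hpq⟩ := infix_of_mem (h' z b)
  have hL : substPow σ (m + (n + (n + n))) 0 ∈ Lang σ := ⟨_, _, List.infix_refl _⟩
  rw [substPow_add, substPow_add, comp, comp, he, apply_cons, apply_cons, apply_cons, ← hpq] at hL
  simp only [apply_append, apply_single] at hL
  obtain ⟨p', q', hw⟩ := hz
  rw [← hw] at hL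
  have e1 : apply (substPow σ m) (substPow σ n a) ≠ [] := by
    have := length_le_apply (ne_substPow h.ne m) (substPow σ n a)
    have := List.length_pos_iff.2 (ne_substPow h.ne n a)
    exact List.length_pos_iff.1 (by omega)
  have e2 : apply (substPow σ m) (substPow σ n c) ≠ [] := by
    have := length_le_apply (ne_substPow h.ne m) (substPow σ n c)
    have := List.length_pos_iff.2 (ne_substPow h.ne n c)
    exact List.length_pos_iff.1 (by omega)
  generalize apply (substPow σ m) (substPow σ n a) = A at *
  generalize apply (substPow σ m) (substPow σ n c) = C at *
  have key : ∀ (P Q : List A2), P ≠ [] → Q ≠ [] → P ++ w ++ Q ∈ Lang σ →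
      ∃ x y, x :: (w ++ [y]) ∈ Lang σ := by
    intro P Q hP hQ hPQ
    obtain ⟨P', x, rfl⟩ := (List.eq_nil_or_concat P).resolve_left hP
    obtain ⟨y, Q', rfl⟩ := List.exists_cons_of_ne_nil hQ
    exact ⟨x, y, lang_infix ⟨P', Q', by simp⟩ hPQ⟩
  refine key (A ++ (apply (substPow σ m) p ++ p')) (q' ++ apply (substPow σ m) q ++ C
    ++ apply (substPow σ m) (apply (substPow σ n) d)) (by simp [e1]) (by simp [e2]) ?_
  simpa using hL

theorem lang_ext_deep {σ : Subst} (h : Prim σ) (l : ℕ) {w : List A2} (hw : w ∈ Lang σ) :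
    ∃ p q, p.length = l ∧ q.length = l ∧ p ++ w ++ q ∈ Lang σ := by
  induction l with
  | zero => exact ⟨[], [], rfl, rfl, by simpa using hw⟩
  | succ l ih =>
    obtain ⟨p, q, hp, hq, hL⟩ := ih
    obtain ⟨x, y, hxy⟩ := lang_ext h hL
    exact ⟨x :: p, q ++ [y], by simp [hp], by simp [hq], by simpa using hxy⟩

end TwoSubst

namespace TwoSubst

/-! ### Hull versus language -/

theorem mem_hull {σ : Subst} {u : ℤ → A2} : u ∈ Hull σ ↔ ∀ w, IsFactor w u → w ∈ Lang σ := Iff.rfl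

theorem isFactor_iff {w : List A2} {u : ℤ → A2} : IsFactor w u ↔
    ∃ k : ℤ, w = (List.range w.length).map fun i : ℕ => u (k + (i : ℤ)) := by
  have e : ∀ l : List ℕ, (do let a ← l; pure (a : ℤ) : List ℤ) = l.map fun a : ℕ => (a : ℤ) := by
    intro l
    induction l with
    | nil => rfl
    | cons x l ih => simpa using ih
  unfold IsFactor
  simp only [e, List.map_map, Function.comp_def]

theorem exists_hull {σ : Subst} (h : Prim σ) {w : List A2} (hw : w ∈ Lang σ) (hne : w ≠ []) :
    ∃ u ∈ Hull σ, IsFactor w u := by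
  choose X Y hXY using fun v : Lang σ => lang_ext h v.2
  let f : ℕ → Lang σ := fun n => Nat.rec ⟨w, hw⟩ (fun _ v => ⟨X v :: (v.1 ++ [Y v]), hXY v⟩) n
  have f0 : (f 0).1 = w := rfl
  have fs : ∀ n, (f (n + 1)).1 = X (f n) :: ((f n).1 ++ [Y (f n)]) := fun n => rfl
  have flen : ∀ n, (f n).1.length = w.length + 2 * n := by
    intro n
    induction n with
    | zero => simp [f0]
    | succ n ih => rw [fs]; simp [ih]; omega
  have hpos := List.length_pos_iff.2 hne
  have shift : ∀ d n k, k < (f n).1.length → (f (n + d)).1[k + d]? = (f n).1[k]? := by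
    intro d
    induction d with
    | zero => intros; rfl
    | succ d ih =>
      intro n k hk
      rw [← Nat.add_assoc, ← Nat.add_assoc, fs, List.getElem?_cons_succ,
        List.getElem?_append_left, ih n k hk]
      rw [flen] at hk ⊢
      omega
  let u : ℤ → A2 := fun i => ((f i.natAbs).1[(i + i.natAbs).toNat]?).getD 0
  have hu : ∀ n k, k < (f n).1.length → (f n).1[k]? = some (u ((k : ℤ) - n)) := by
    intro n k hk
    obtain ⟨i, hi⟩ : ∃ i : ℤ, i = (k : ℤ) - n := ⟨_, rfl⟩
    rw [← hi]
    have hlt : (i + i.natAbs).toNat < (f i.natAbs).1.length := by rw [flen]; omega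
    have e : (f n).1[k]? = (f i.natAbs).1[(i + i.natAbs).toNat]? := by
      rcases le_total n i.natAbs with hc | hc
      · rw [← shift (i.natAbs - n) n k hk]
        have e1 : n + (i.natAbs - n) = i.natAbs := by omega
        have e2 : k + (i.natAbs - n) = (i + i.natAbs).toNat := by omega
        rw [e1, e2]
      · rw [← shift (n - i.natAbs) i.natAbs _ hlt]
        have e1 : i.natAbs + (n - i.natAbs) = n := by omega
        have e2 : (i + i.natAbs).toNat + (n - i.natAbs) = k := by omega
        rw [e1, e2]
    rw [e]
    simp only [u]
    rw [List.getElem?_eq_getElem hlt]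
    rfl
  refine ⟨u, ?_, ?_⟩
  · rw [mem_hull]
    intro v hv
    obtain ⟨k, hk⟩ := isFactor_iff.1 hv
    have : v <:+: (f (k.natAbs + v.length)).1 := by
      have e : v = (((f (k.natAbs + v.length)).1.drop (k + (k.natAbs + v.length : ℕ)).toNat).take
          v.length) := by
        apply List.ext_getElem?
        intro j
        rw [List.getElem?_take]
        split_ifs with hj
        · rw [List.getElem?_drop, hu]
          · conv_lhs => rw [hk]
            rw [List.getElem?_map, List.getElem?_range hj]
            simp only [Option.map_some]
            congr 2
            omega
          · rw [flen]; omega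
        · simp; omega
      refine List.IsInfix.trans (show v <:+: _ from ⟨[], [], by simpa using e⟩) ?_
      exact (List.take_prefix _ _).isInfix.trans (List.drop_suffix _ _).isInfix
    exact lang_infix this (f _).2
  · refine isFactor_iff.2 ⟨0, ?_⟩
    apply List.ext_getElem?
    intro j
    by_cases hj : j < w.length
    · have := hu 0 j (by rw [flen]; omega)
      rw [f0] at this
      rw [this, List.getElem?_map, List.getElem?_range hj]
      simp
    · rw [List.getElem?_eq_none (by omega), List.getElem?_eq_none (by simp; omega)]

theorem hull_eq_iff_lang_eq {σ ρ : Subst} (hσ : Prim σ) (hρ : Prim ρ) :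
    Hull σ = Hull ρ ↔ Lang σ = Lang ρ := by
  constructor
  · intro h
    have : ∀ σ ρ : Subst, Prim σ → Hull σ = Hull ρ → Lang σ ⊆ Lang ρ := by
      intro σ ρ hσ h w hw
      by_cases hne : w = []
      · subst hne; exact ⟨0, 0, List.nil_infix⟩
      · obtain ⟨u, hu, hf⟩ := exists_hull hσ hw hne
        rw [h] at hu
        exact hu w hf
    exact Set.Subset.antisymm (this σ ρ hσ h) (this ρ σ hρ h.symm)
  · intro h
    ext u
    rw [mem_hull, mem_hull, h]

/-! ### Counting -/

theorem count_apply (σ : Subst) (i : A2) (w : List A2) :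
    (((apply σ w).count i : ℕ) : ℤ) = ∑ j, M σ i j * (w.count j : ℤ) := by
  induction w with
  | nil => simp [apply_nil]
  | cons x w ih =>
    rw [apply_cons, List.count_append]
    push_cast
    rw [ih]
    simp only [Fin.sum_univ_two, List.count_cons]
    fin_cases x <;> simp [M] <;> ring

theorem M_comp (σ τ : Subst) : M (comp σ τ) = M σ * M τ := by
  ext i j
  rw [Matrix.mul_apply]
  exact count_apply σ i (τ j)

theorem M_substPow (σ : Subst) (n : ℕ) : M (substPow σ n) = M σ ^ n := by
  induction n with
  | zero =>
    ext i j
    fin_cases i <;> fin_cases j <;> simp [M, substPow]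
  | succ n ih => rw [substPow_succ, M_comp, ih, pow_succ]

theorem Primitive.prim {σ : Subst} (h : Primitive σ) : Prim σ := by
  obtain ⟨n, hn, h⟩ := h
  refine ⟨n, hn, fun x y => ?_⟩
  have := h x y
  rw [← M_substPow] at this
  exact List.count_pos_iff.1 (by simpa [M] using this)

/-! ### Conjugacy -/

theorem toFG_append (u v : List A2) : toFG (u ++ v) = toFG u * toFG v := by simp [toFG]

theorem endo_of (σ : Subst) (i : A2) : endo σ (FreeGroup.of i) = toFG (σ i) := by
  exact FreeGroup.lift_apply_of

theorem endo_toFG (σ : Subst) (w : List A2) : endo σ (toFG w) = toFG (apply σ w) := by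
  induction w with
  | nil => simp [toFG, apply]
  | cons x w ih =>
    rw [apply_cons, toFG_append, ← ih, ← endo_of, ← map_mul]
    simp [toFG]

theorem fg_hom_ext (f g : FreeGroup A2 →* FreeGroup A2)
    (h : ∀ i, f (FreeGroup.of i) = g (FreeGroup.of i)) (x : FreeGroup A2) : f x = g x :=
  DFunLike.congr_fun (FreeGroup.ext_hom f g h) x

theorem endo_comp (σ τ : Subst) (x : FreeGroup A2) : endo (comp σ τ) x = endo σ (endo τ x) := by
  refine fg_hom_ext (endo (comp σ τ)) (MonoidHom.comp (endo σ) (endo τ)) (fun i => ?_) x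
  change endo (comp σ τ) (FreeGroup.of i) = endo σ (endo τ (FreeGroup.of i))
  rw [endo_of, endo_of, endo_toFG]
  rfl

theorem endo_idS (x : FreeGroup A2) : endo idS x = x := by
  refine fg_hom_ext (endo idS) (MonoidHom.id _) (fun i => ?_) x
  change endo idS (FreeGroup.of i) = FreeGroup.of i
  rw [endo_of]
  simp [toFG, idS]

theorem conj_of {σ ρ : Subst} (w : FreeGroup A2)
    (h : ∀ i, toFG (σ i) = w * toFG (ρ i) * w⁻¹) : Conj σ ρ := by
  refine ⟨w, fun x => ?_⟩
  refine fg_hom_ext (endo σ) (MonoidHom.comp (MulAut.conj w).toMonoidHom (endo ρ)) (fun i => ?_) x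
  change endo σ (FreeGroup.of i) = w * endo ρ (FreeGroup.of i) * w⁻¹
  rw [endo_of, endo_of, h]

theorem Conj.refl (σ : Subst) : Conj σ σ := ⟨1, by simp⟩

theorem Conj.symm {σ ρ : Subst} (h : Conj σ ρ) : Conj ρ σ := by
  obtain ⟨w, h⟩ := h
  exact ⟨w⁻¹, fun x => by rw [h]; group⟩

theorem Conj.trans {σ ρ τ : Subst} (h : Conj σ ρ) (h' : Conj ρ τ) : Conj σ τ := by
  obtain ⟨w, h⟩ := h
  obtain ⟨v, h'⟩ := h'
  exact ⟨w * v, fun x => by rw [h, h']; group⟩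

theorem Conj.comp {σ ρ σ' ρ' : Subst} (h : Conj σ ρ) (h' : Conj σ' ρ') :
    Conj (comp σ σ') (comp ρ ρ') := by
  obtain ⟨w, h⟩ := h
  obtain ⟨v, h'⟩ := h'
  refine ⟨w * endo ρ v, fun x => ?_⟩
  rw [endo_comp, endo_comp, h, h']
  simp only [map_mul, map_inv]
  group

theorem Conj.pow {σ ρ : Subst} (h : Conj σ ρ) (n : ℕ) : Conj (substPow σ n) (substPow ρ n) := by
  induction n with
  | zero => exact Conj.refl _
  | succ n ih => rw [substPow_succ, substPow_succ]; exact ih.comp h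

theorem expSum_toFG (i : A2) (w : List A2) :
    expSum i (toFG w) = Multiplicative.ofAdd ((w.count i : ℕ) : ℤ) := by
  induction w with
  | nil => simp [toFG]
  | cons x w ih =>
    have : toFG (x :: w) = FreeGroup.of x * toFG w := by simp [toFG]
    rw [this, map_mul, ih, expSum, FreeGroup.lift_apply_of, ← ofAdd_add, List.count_cons]
    congr 1
    by_cases hx : x = i <;> simp [hx, add_comm]

theorem Conj.count {σ ρ : Subst} (h : Conj σ ρ) (i j : A2) :
    (σ j).count i = (ρ j).count i := by
  obtain ⟨w, h⟩ := h
  have := congrArg (expSum i) (h (FreeGroup.of j))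
  rw [endo_of, endo_of, map_mul, map_mul, map_inv, mul_inv_cancel_comm, expSum_toFG,
    expSum_toFG] at this
  exact_mod_cast Multiplicative.ofAdd.injective this

theorem Conj.prim {σ ρ : Subst} (h : Conj σ ρ) (hσ : Prim σ) : Prim ρ := by
  obtain ⟨n, hn, h'⟩ := hσ
  refine ⟨n, hn, fun x y => ?_⟩
  rw [← List.count_pos_iff, ← (h.pow n).count]
  exact List.count_pos_iff.2 (h' x y)

/-- positive words -/
def pos (l : List A2) : List (A2 × Bool) := l.map fun x => (x, true)

/-- inverses of positive words -/
def neg (l : List A2) : List (A2 × Bool) := l.reverse.map fun x => (x, false)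

theorem toFG_eq (l : List A2) : toFG l = FreeGroup.mk (pos l) := by
  induction l with
  | nil => rfl
  | cons x l ih =>
    have : toFG (x :: l) = FreeGroup.of x * toFG l := by simp [toFG]
    rw [this, ih]; rfl

theorem toFG_inv (l : List A2) : (toFG l)⁻¹ = FreeGroup.mk (neg l) := by
  rw [toFG_eq, FreeGroup.inv_mk]
  simp [FreeGroup.invRev, pos, neg, Function.comp_def]

theorem pos_append (u v : List A2) : pos (u ++ v) = pos u ++ pos v := by simp [pos]

theorem pos_reduced (l : List A2) : FreeGroup.IsReduced (pos l) := by
  unfold pos FreeGroup.IsReduced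
  rw [List.isChain_map]
  exact List.Pairwise.isChain (List.pairwise_of_forall (by simp))

theorem neg_reduced (l : List A2) : FreeGroup.IsReduced (neg l) := by
  unfold neg FreeGroup.IsReduced
  rw [List.isChain_map]
  exact List.Pairwise.isChain (List.pairwise_of_forall (by simp))

theorem toWord_toFG (l : List A2) : (toFG l).toWord = pos l := by
  rw [toFG_eq, FreeGroup.toWord_mk, (pos_reduced l).reduce_eq]

/-- multiplication by one letter -/
theorem toWord_letter_mul (c : A2 × Bool) (x : FreeGroup A2) :
    (FreeGroup.mk [c] * x).toWord = c :: x.toWord ∨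
    (FreeGroup.mk [c] * x).toWord = x.toWord.tail := by
  rw [FreeGroup.toWord_mul, FreeGroup.toWord_mk, FreeGroup.reduce_singleton,
    List.singleton_append, FreeGroup.reduce.cons, FreeGroup.reduce_toWord]
  rcases x.toWord with _ | ⟨d, t⟩
  · simp
  · simp only
    split_ifs
    · right; rfl
    · left; rfl

theorem infix_left (g : List (A2 × Bool)) (x : FreeGroup A2) (p m q : List (A2 × Bool))
    (hp : g.length ≤ p.length) (hx : x.toWord = p ++ m ++ q) :
    ∃ p', (FreeGroup.mk g * x).toWord = p' ++ m ++ q ∧ p.length ≤ p'.length + g.length := by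
  induction g with
  | nil => exact ⟨p, by simpa [← FreeGroup.one_eq_mk] using hx, by simp⟩
  | cons c g ih =>
    rw [List.length_cons] at hp
    obtain ⟨p', h1, h2⟩ := ih (by omega)
    have e : FreeGroup.mk (c :: g) * x = FreeGroup.mk [c] * (FreeGroup.mk g * x) := by
      rw [← mul_assoc, FreeGroup.mul_mk]; rfl
    rw [e]
    rcases toWord_letter_mul c (FreeGroup.mk g * x) with h | h
    · exact ⟨c :: p', by rw [h, h1]; simp, by simp; omega⟩
    · have : p' ≠ [] := by
        intro h0; subst h0; simp at h2; omega
      obtain ⟨d, p'', rfl⟩ := List.exists_cons_of_ne_nil this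
      refine ⟨p'', by rw [h, h1]; simp, ?_⟩
      simp at h2 ⊢; omega

theorem infix_right (g : List (A2 × Bool)) (x : FreeGroup A2) (p m q : List (A2 × Bool))
    (hq : g.length ≤ q.length) (hx : x.toWord = p ++ m ++ q) :
    ∃ q', (x * (FreeGroup.mk g)⁻¹).toWord = p ++ m ++ q' := by
  obtain ⟨p', h1, -⟩ := infix_left g x⁻¹ (FreeGroup.invRev q) (FreeGroup.invRev m)
    (FreeGroup.invRev p) (by simpa using hq) (by rw [FreeGroup.toWord_inv, hx]; simp)
  refine ⟨FreeGroup.invRev p', ?_⟩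
  have : x * (FreeGroup.mk g)⁻¹ = (FreeGroup.mk g * x⁻¹)⁻¹ := by group
  rw [this, FreeGroup.toWord_inv, h1]
  simp

theorem pos_infix {u v : List A2} (h : pos u <:+: pos v) : u <:+: v := by
  obtain ⟨p, q, h⟩ := h
  have := congrArg (List.map Prod.fst) h
  refine ⟨p.map Prod.fst, q.map Prod.fst, ?_⟩
  simpa [pos, Function.comp_def] using this

/-- The middle of a word survives conjugation. -/
theorem middle_infix (w : FreeGroup A2) (p m q v : List A2) (hp : w.toWord.length ≤ p.length)
    (hq : w.toWord.length ≤ q.length) (h : toFG v = w * toFG (p ++ m ++ q) * w⁻¹) :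
    m <:+: v := by
  obtain ⟨p', h1, -⟩ := infix_left w.toWord (toFG (p ++ m ++ q)) (pos p) (pos m) (pos q)
    (by simpa [pos] using hp) (by rw [toWord_toFG]; simp [pos])
  obtain ⟨q', h2⟩ := infix_right w.toWord _ _ _ _ (by simpa [pos] using hq) h1
  rw [FreeGroup.mk_toWord, ← h, toWord_toFG] at h2
  exact pos_infix ⟨p', q', h2.symm⟩

theorem Conj.lang_subset {σ ρ : Subst} (h : Conj σ ρ) (hσ : Prim σ) : Lang ρ ⊆ Lang σ := by
  have hρ := h.prim hσ
  rintro v ⟨n, x, hv⟩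
  obtain ⟨w, hw⟩ := h.pow n
  obtain ⟨p, q, hp, hq, hL⟩ := lang_ext_deep hσ w.toWord.length (lang_single σ x)
  have h1 := hw (toFG (p ++ [x] ++ q))
  rw [endo_toFG, endo_toFG] at h1
  rw [apply_append (substPow ρ n), apply_append (substPow ρ n), apply_single] at h1
  have l1 := length_le_apply (ne_substPow hρ.ne n) p
  have l2 := length_le_apply (ne_substPow hρ.ne n) q
  have := middle_infix w _ _ _ _ (by omega) (by omega) h1
  exact lang_infix (hv.trans this) (lang_apply_pow hL n)

theorem Conj.lang {σ ρ : Subst} (h : Conj σ ρ) (hσ : Prim σ) : Lang σ = Lang ρ :=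
  Set.Subset.antisymm (h.symm.lang_subset (h.prim hσ)) (h.lang_subset hσ)

end TwoSubst

namespace TwoSubst

/-! ### The monoid generated by the two elementary substitutions -/

/-- `R i` fixes `i` and maps the other letter `j` to `ij`. -/
def R (i : A2) : Subst := fun j => if j = i then [i] else [i, j]

/-- products of elementary substitutions -/
def S : List A2 → Subst
  | [] => idS
  | i :: W => comp (R i) (S W)

theorem S_append (W V : List A2) : S (W ++ V) = comp (S W) (S V) := by
  induction W with
  | nil => exact (idS_comp _).symm
  | cons i W ih => simp only [List.cons_append, S, ih, comp_assoc]

theorem S_single (i : A2) : S [i] = R i := comp_idS _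

theorem S_replicate (W : List A2) (k : ℕ) : S (List.replicate k W).flatten = substPow (S W) k := by
  induction k with
  | zero => rfl
  | succ k ih => rw [List.replicate_succ, List.flatten_cons, S_append, ih, substPow_succ']

theorem mem_R (i x : A2) : x ∈ R i x := by
  unfold R; split_ifs with h <;> simp [h]

theorem mem_S (W : List A2) (x : A2) : x ∈ S W x := by
  induction W with
  | nil => simp [S, idS]
  | cons i W ih => exact mem_apply.2 ⟨x, ih, mem_R i x⟩

theorem R_self (i : A2) : R i i = [i] := by simp [R]

theorem R_ne {i j : A2} (h : j ≠ i) : R i j = [i, j] := by simp [R, h]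

theorem R_head (i : A2) (z : List A2) (hz : z ≠ []) : ∃ t, apply (R i) z = i :: t := by
  obtain ⟨y, z, rfl⟩ := List.exists_cons_of_ne_nil hz
  rw [apply_cons]
  by_cases h : y = i
  · subst h; exact ⟨_, by rw [R_self]; rfl⟩
  · exact ⟨_, by rw [R_ne h]; rfl⟩

theorem R_head' (i : A2) (z : List A2) : ∃ t, apply (R i) z ++ [i] = i :: t := by
  by_cases h : z = []
  · subst h; exact ⟨[], rfl⟩
  · obtain ⟨t, ht⟩ := R_head i z h
    exact ⟨t ++ [i], by rw [ht]; rfl⟩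

theorem R_not_head {i y : A2} (h : y ≠ i) (z u : List A2) : ¬ (y :: u) <+: apply (R i) z := by
  intro hp
  by_cases hz : z = []
  · subst hz; simp [apply_nil] at hp
  · obtain ⟨t, ht⟩ := R_head i z hz
    rw [ht, List.cons_prefix_cons] at hp
    exact h hp.1

theorem R_prefix (i : A2) (w z : List A2) (h : apply (R i) w ++ [i] <+: apply (R i) z) :
    w <+: z := by
  induction w generalizing z with
  | nil => exact List.nil_prefix
  | cons x w ih =>
    rcases z with _ | ⟨y, z⟩
    · simp [apply_nil] at h
    · rw [apply_cons, apply_cons, List.append_assoc] at h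
      by_cases hx : x = i <;> by_cases hy : y = i
      · subst hx; subst hy
        rw [List.prefix_append_right_inj] at h
        rw [List.cons_prefix_cons]
        exact ⟨rfl, ih z h⟩
      · subst hx
        rw [R_self, R_ne hy] at h
        obtain ⟨t, ht⟩ := R_head' x w
        rw [ht] at h
        simp only [List.cons_append, List.nil_append, List.cons_prefix_cons] at h
        exact absurd h.2.1.symm hy
      · subst hy
        rw [R_self, R_ne hx] at h
        simp only [List.cons_append, List.nil_append, List.cons_prefix_cons, true_and] at h
        exact absurd h (R_not_head hx _ _)
      · rw [R_ne hx, R_ne hy] at h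
        simp only [List.cons_append, List.nil_append, List.cons_prefix_cons, true_and] at h
        rw [List.cons_prefix_cons]
        exact ⟨h.1, ih z h.2⟩

theorem R_infix (i : A2) (w z : List A2) (h : apply (R i) w ++ [i] <:+: apply (R i) z) :
    w <:+: z := by
  induction z with
  | nil => simp [apply_nil] at h
  | cons y z ih =>
    by_cases hy : y = i
    · have h' := h
      rw [apply_cons, hy, R_self, List.singleton_append, List.infix_cons_iff] at h'
      rcases h' with h' | h'
      · refine (R_prefix i w (y :: z) ?_).isInfix
        rw [apply_cons, hy, R_self]; exact h'
      · exact (ih h').trans (List.infix_cons_iff.2 (Or.inr (List.infix_refl _)))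
    · have h' := h
      rw [apply_cons, R_ne hy, List.cons_append, List.infix_cons_iff] at h'
      rcases h' with h' | h'
      · refine (R_prefix i w (y :: z) ?_).isInfix
        rw [apply_cons, R_ne hy]; exact h'
      · rw [List.cons_append, List.infix_cons_iff] at h'
        rcases h' with h' | h'
        · obtain ⟨t, ht⟩ := R_head' i w
          rw [ht, List.cons_prefix_cons] at h'
          exact absurd h'.1.symm hy
        · exact (ih h').trans (List.infix_cons_iff.2 (Or.inr (List.infix_refl _)))

theorem R_no_jj {i j : A2} (hj : j ≠ i) (z : List A2) : ¬ [j, j] <:+: apply (R i) z := by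
  induction z with
  | nil => simp [apply_nil]
  | cons y z ih =>
    intro h
    by_cases hy : y = i
    · rw [apply_cons, hy, R_self, List.singleton_append, List.infix_cons_iff] at h
      rcases h with h | h
      · rw [List.cons_prefix_cons] at h; exact hj h.1
      · exact ih h
    · rw [apply_cons, R_ne hy, List.cons_append, List.cons_append, List.nil_append,
        List.infix_cons_iff, List.infix_cons_iff] at h
      rcases h with h | h | h
      · rw [List.cons_prefix_cons] at h; exact hj h.1
      · rw [List.cons_prefix_cons] at h; exact R_not_head hj _ _ h.2
      · exact ih h

theorem pow_comp_comm (A B : Subst) (n : ℕ) :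
    comp (substPow (comp A B) n) A = comp A (substPow (comp B A) n) := by
  induction n with
  | zero => rw [substPow_zero, substPow_zero, idS_comp, comp_idS]
  | succ n ih =>
    rw [substPow_succ, comp_assoc, comp_assoc, ← comp_assoc, ih, comp_assoc, substPow_succ]

theorem pow_succ_comp (A B : Subst) (n : ℕ) :
    substPow (comp A B) (n + 1) = comp A (comp (substPow (comp B A) n) B) := by
  rw [substPow_succ, ← comp_assoc, pow_comp_comm, comp_assoc]

theorem prim_rot {i : A2} {W : List A2} (h : Prim (S (i :: W))) : Prim (S (W ++ [i])) := by
  obtain ⟨n, hn, h⟩ := h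
  refine ⟨n + 1, Nat.succ_pos n, fun x y => ?_⟩
  rw [S_append, S_single, pow_succ_comp]
  refine mem_apply.2 ⟨x, ?_, mem_S W x⟩
  exact mem_apply.2 ⟨y, mem_R i y, h x y⟩

theorem lang_rot {i : A2} {W : List A2} (h : Prim (S (i :: W))) (w : List A2) :
    w ∈ Lang (S (W ++ [i])) ↔ apply (R i) w ++ [i] ∈ Lang (S (i :: W)) := by
  have hT := prim_rot h
  constructor
  · intro hw
    obtain ⟨x, y, hxy⟩ := lang_ext hT hw
    obtain ⟨n, z, hz⟩ := lang_infix (u := w ++ [y]) ⟨[x], [], by simp⟩ hxy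
    obtain ⟨m, hm, hp⟩ := hT
    rw [S_append, S_single] at hz hp
    have h1 : apply (R i) (w ++ [y]) ∈ Lang (S (i :: W)) := by
      refine ⟨n + m + 1, 0, ?_⟩
      rw [S, pow_succ_comp]
      refine apply_infix _ (hz.trans ?_)
      rw [substPow_add, comp_assoc]
      have : z ∈ comp (substPow (comp (S W) (R i)) m) (S W) 0 :=
        mem_apply.2 ⟨0, mem_S W 0, hp z 0⟩
      rw [← apply_single (substPow (comp (S W) (R i)) n) z]
      exact apply_infix _ (infix_of_mem this)
    refine lang_infix ?_ h1
    rw [apply_append]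
    obtain ⟨t, ht⟩ := R_head i [y] (by simp)
    rw [ht]
    exact ⟨[], t, by simp⟩
  · rintro ⟨n, x, hx⟩
    obtain ⟨y, hy⟩ := h.surj1 x
    have h1 : apply (R i) w ++ [i] <:+: substPow (S (i :: W)) (n + 1) y := by
      refine hx.trans ?_
      rw [substPow_succ, ← apply_single (substPow _ _) x]
      exact apply_infix _ (infix_of_mem hy)
    rw [S, pow_succ_comp] at h1
    have h2 := R_infix i _ _ h1
    refine ⟨n + 1, y, ?_⟩
    rw [S_append, S_single, substPow_succ, ← comp_assoc]
    refine h2.trans ?_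
    rw [← apply_single (comp _ _) y]
    exact apply_infix _ (infix_of_mem (mem_R i y))

theorem ii_mem {i : A2} {W : List A2} (h : Prim (S (i :: W))) : [i, i] ∈ Lang (S (i :: W)) := by
  have := (lang_rot h [i]).1 (lang_single _ i)
  rwa [apply_single, R_self] at this

theorem jj_not_mem {i j : A2} (hj : j ≠ i) (W : List A2) : [j, j] ∉ Lang (S (i :: W)) := by
  rintro ⟨n, x, hx⟩
  rcases n with _ | n
  · have := hx.length_le
    simp [substPow] at this
  · rw [substPow_succ', S, comp_assoc] at hx
    exact R_no_jj hj _ hx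

theorem eq_of_lang (n : ℕ) : ∀ W V P : List A2, W.length = n → V.length = n →
    Prim (S (W ++ P)) → Prim (S (V ++ P)) → Lang (S (W ++ P)) = Lang (S (V ++ P)) → W = V := by
  induction n with
  | zero =>
    intro W V P hW hV _ _ _
    rw [List.length_eq_zero_iff.1 hW, List.length_eq_zero_iff.1 hV]
  | succ n ih =>
    intro W V P hW hV pW pV hL
    rcases W with _ | ⟨i, W⟩
    · simp at hW
    rcases V with _ | ⟨j, V⟩
    · simp at hV
    rw [List.cons_append] at pW pV hL
    rw [List.cons_append] at hL
    have hij : i = j := by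
      by_contra hne
      have := ii_mem pW
      rw [hL] at this
      exact jj_not_mem hne _ this
    subst hij
    congr 1
    refine ih W V (P ++ [i]) (by simpa using hW) (by simpa using hV) ?_ ?_ ?_
    · rw [← List.append_assoc]; exact prim_rot pW
    · rw [← List.append_assoc]; exact prim_rot pV
    · ext w
      rw [← List.append_assoc, ← List.append_assoc, lang_rot pW, lang_rot pV, hL]

end TwoSubst

namespace TwoSubst

/-! ### Structure of invertible substitutions -/

theorem IsInvertible.conj {σ ρ : Subst} (h : Conj σ ρ) (hσ : IsInvertible σ) : IsInvertible ρ := by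
  obtain ⟨w, h⟩ := h.symm
  have : (endo ρ : FreeGroup A2 → FreeGroup A2) = (MulAut.conj w) ∘ (endo σ) := by
    funext x; simp [h]
  unfold IsInvertible
  rw [this]
  exact (MulAut.conj w).bijective.comp hσ

/-- first part of the reduced image of a letter -/
def P (c : A2 → List A2) (s : List A2) (h : A2 × Bool) : List (A2 × Bool) :=
  if h.2 then pos (c h.1) else neg s ++ neg (c h.1)

theorem append_reduced {u v : List (A2 × Bool)} (hu : FreeGroup.IsReduced u)
    (hv : FreeGroup.IsReduced v)
    (h : ∀ x ∈ u.getLast?, ∀ y ∈ v.head?, x.1 = y.1 → x.2 = y.2) :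
    FreeGroup.IsReduced (u ++ v) := List.IsChain.append hu hv h

theorem pos_getLast {l : List A2} {x : A2 × Bool} (h : x ∈ (pos l).getLast?) :
    x.2 = true ∧ x.1 ∈ l.getLast? := by
  simp only [pos, List.getLast?_map, Option.mem_def, Option.map_eq_some_iff] at h
  obtain ⟨a, h1, rfl⟩ := h
  exact ⟨rfl, h1⟩

theorem pos_head {l : List A2} {x : A2 × Bool} (h : x ∈ (pos l).head?) :
    x.2 = true ∧ x.1 ∈ l.head? := by
  simp only [pos, List.head?_map, Option.mem_def, Option.map_eq_some_iff] at h
  obtain ⟨a, h1, rfl⟩ := h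
  exact ⟨rfl, h1⟩

theorem neg_getLast {l : List A2} {x : A2 × Bool} (h : x ∈ (neg l).getLast?) :
    x.2 = false ∧ x.1 ∈ l.head? := by
  simp only [neg, List.getLast?_map, List.getLast?_reverse, Option.mem_def,
    Option.map_eq_some_iff] at h
  obtain ⟨a, h1, rfl⟩ := h
  exact ⟨rfl, h1⟩

theorem neg_head {l : List A2} {x : A2 × Bool} (h : x ∈ (neg l).head?) :
    x.2 = false ∧ x.1 ∈ l.getLast? := by
  simp only [neg, List.head?_map, List.head?_reverse, Option.mem_def,
    Option.map_eq_some_iff] at h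
  obtain ⟨a, h1, rfl⟩ := h
  exact ⟨rfl, h1⟩

theorem head_append {u v : List (A2 × Bool)} (hu : u ≠ []) : (u ++ v).head? = u.head? := by
  obtain ⟨x, t, rfl⟩ := List.exists_cons_of_ne_nil hu
  rfl

theorem pos_ne {l : List A2} (h : l ≠ []) : pos l ≠ [] := by simpa [pos] using h

theorem neg_ne {l : List A2} (h : l ≠ []) : neg l ≠ [] := by simpa [neg] using h

theorem neg_append (u v : List A2) : neg (u ++ v) = neg v ++ neg u := by simp [neg]

theorem endo_letter {σ : Subst} (h : A2 × Bool) :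
    endo σ (FreeGroup.mk [h]) = FreeGroup.mk (if h.2 then pos (σ h.1) else neg (σ h.1)) := by
  rcases h with ⟨i, _ | _⟩
  · have : (FreeGroup.mk [(i, false)] : FreeGroup A2) = (FreeGroup.of i)⁻¹ := rfl
    rw [this, map_inv, endo_of, toFG_inv]; simp
  · have : (FreeGroup.mk [(i, true)] : FreeGroup A2) = FreeGroup.of i := rfl
    rw [this, endo_of, toFG_eq]; simp

theorem mk_pos_neg (s : List A2) (r : List (A2 × Bool)) :
    (FreeGroup.mk (pos s ++ (neg s ++ r)) : FreeGroup A2) = FreeGroup.mk r := by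
  rw [← FreeGroup.mul_mk, ← FreeGroup.mul_mk, ← toFG_inv, toFG_eq]; group

theorem core_reduced {σ : Subst} (c : A2 → List A2) (s : List A2) (hσ : ∀ i, σ i = c i ++ s)
    (hc : ∀ i, c i ≠ []) (hh : ∀ i j x, x ∈ (c i).head? → x ∈ (c j).head? → i = j)
    (hl : ∀ i j x, x ∈ (c i).getLast? → x ∈ (c j).getLast? → i = j)
    (t : List (A2 × Bool)) : ∀ h : A2 × Bool, FreeGroup.IsReduced (h :: t) →
    ∃ r, endo σ (FreeGroup.mk (h :: t)) = FreeGroup.mk (P c s h ++ r) ∧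
      FreeGroup.IsReduced (P c s h ++ r) ∧ t.length ≤ r.length := by
  induction t with
  | nil =>
    rintro ⟨i, _ | _⟩ -
    · refine ⟨[], ?_, ?_, by simp⟩
      · rw [endo_letter, hσ, neg_append]; simp [P]
      · simp only [P, ← neg_append, List.append_nil]; exact neg_reduced _
    · refine ⟨pos s, ?_, ?_, by simp⟩
      · rw [endo_letter, hσ, pos_append]; simp [P]
      · simp only [P, if_true, ← pos_append]; exact pos_reduced _
  | cons h' t ih =>
    rintro ⟨i, b⟩ hred
    rw [FreeGroup.isReduced_cons_cons] at hred
    obtain ⟨r, h1, h2, h3⟩ := ih h' hred.2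
    have hred1 := hred.1
    have e : endo σ (FreeGroup.mk ((i, b) :: h' :: t))
        = FreeGroup.mk ((if b then pos (σ i) else neg (σ i)) ++ (P c s h' ++ r)) := by
      rw [← FreeGroup.mul_mk, ← h1, ← endo_letter (i, b), ← map_mul, FreeGroup.mul_mk]; rfl
    rw [e, hσ]
    rcases h' with ⟨j, _ | _⟩ <;> rcases b with _ | _ <;>
      simp only [P, Bool.false_eq_true, if_true, if_false] at *
    · -- neg neg
      refine ⟨neg s ++ neg (c j) ++ r, by rw [neg_append], ?_, ?_⟩
      · rw [← neg_append]
        refine append_reduced (neg_reduced _) h2 fun x hx y hy _ => ?_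
        rw [(neg_getLast hx).1, ← neg_append, head_append (neg_ne (by simp [hc]))] at *
        rw [(neg_head hy).1]
      · have := List.length_pos_iff.2 (neg_ne (hc j))
        simp; omega
    · -- pos neg
      have hij : i ≠ j := fun h => by simpa using hred1 h
      refine ⟨neg (c j) ++ r, ?_, ?_, ?_⟩
      · rw [pos_append, List.append_assoc, List.append_assoc, ← FreeGroup.mul_mk, mk_pos_neg,
          FreeGroup.mul_mk]
      · rw [List.append_assoc] at h2
        refine append_reduced (pos_reduced _) (h2.infix (List.suffix_append _ _).isInfix)
          fun x hx y hy hxy => ?_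
        rw [head_append (neg_ne (hc j))] at hy
        exact absurd (hl i j x.1 (pos_getLast hx).2 (hxy ▸ (neg_head hy).2)) hij
      · have := List.length_pos_iff.2 (neg_ne (hc j))
        simp; omega
    · -- neg pos
      have hij : i ≠ j := fun h => by simpa using hred1 h
      refine ⟨pos (c j) ++ r, by rw [neg_append], ?_, ?_⟩
      · rw [← neg_append]
        refine append_reduced (neg_reduced _) h2 fun x hx y hy hxy => ?_
        rw [head_append (pos_ne (hc j))] at hy
        have hx2 := (neg_getLast hx).2
        rw [List.head?_append_of_ne_nil _ (hc i)] at hx2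
        exact absurd (hh i j x.1 hx2 (hxy ▸ (pos_head hy).2)) hij
      · have := List.length_pos_iff.2 (pos_ne (hc j))
        simp; omega
    · -- pos pos
      refine ⟨pos s ++ (pos (c j) ++ r), by rw [pos_append, List.append_assoc], ?_, ?_⟩
      · rw [← List.append_assoc, ← pos_append]
        refine append_reduced (pos_reduced _) h2 fun x hx y hy _ => ?_
        rw [head_append (pos_ne (hc j))] at hy
        rw [(pos_getLast hx).1, (pos_head hy).1]
      · have := List.length_pos_iff.2 (pos_ne (hc j))
        simp; omega

theorem core {σ : Subst} (hsurj : Function.Surjective (endo σ))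
    (c : A2 → List A2) (s : List A2) (hσ : ∀ i, σ i = c i ++ s)
    (hc : ∀ i, c i ≠ []) (hh : ∀ i j x, x ∈ (c i).head? → x ∈ (c j).head? → i = j)
    (hl : ∀ i j x, x ∈ (c i).getLast? → x ∈ (c j).getLast? → i = j) (x : A2) :
    ∃ i, σ i = [x] := by
  obtain ⟨g, hg⟩ := hsurj (FreeGroup.of x)
  have hr := FreeGroup.isReduced_toWord (x := g)
  rw [← FreeGroup.mk_toWord (x := g)] at hg
  generalize g.toWord = G at hg hr
  rcases G with _ | ⟨h, t⟩
  · rw [← FreeGroup.one_eq_mk, map_one] at hg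
    exact absurd hg (FreeGroup.one_ne_of x)
  · rcases t with _ | ⟨h', t⟩
    · rw [endo_letter] at hg
      have hg' := congrArg FreeGroup.toWord hg
      rw [FreeGroup.toWord_of, FreeGroup.toWord_mk] at hg'
      rcases h with ⟨i, _ | _⟩
      · simp only [Bool.false_eq_true, if_false] at hg'
        rw [(neg_reduced _).reduce_eq] at hg'
        have : ((x, true) : A2 × Bool) ∈ neg (σ i) := by rw [hg']; simp
        simp [neg] at this
      · simp only [if_true] at hg'
        rw [(pos_reduced _).reduce_eq] at hg'
        refine ⟨i, ?_⟩
        have := congrArg (List.map Prod.fst) hg'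
        simpa [pos, Function.comp_def] using this
    · obtain ⟨r, h1, h2, h3⟩ := core_reduced c s hσ hc hh hl (h' :: t) h hr
      rw [hg] at h1
      have h4 := congrArg (fun z => (FreeGroup.toWord z).length) h1
      simp only [FreeGroup.toWord_of, FreeGroup.toWord_mk, h2.reduce_eq] at h4
      have : P c s h ≠ [] := by
        unfold P
        split_ifs
        · exact pos_ne (hc _)
        · simp [neg_ne (hc _)]
      have := List.length_pos_iff.2 this
      simp at h3 h4
      omega

/-- build a substitution -/
def mkS (u v : List A2) : Subst := ![u, v]

theorem mkS_eta (σ : Subst) : mkS (σ 0) (σ 1) = σ := by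
  funext i; fin_cases i <;> rfl

/-- Rotation lemma -/
theorem rotate (n : ℕ) : ∀ p q s : List A2, p.length + q.length = n →
    ∃ p' q' s', Conj (mkS (p ++ s) (q ++ s)) (mkS (p' ++ s') (q' ++ s')) ∧
      (p' ++ s').length = (p ++ s).length ∧ (q' ++ s').length = (q ++ s).length ∧
      (p' = [] ∨ q' = [] ∨ (p' ≠ [] ∧ q' ≠ [] ∧ p'.head? ≠ q'.head? ∧
        p'.getLast? ≠ q'.getLast?)) := by
  induction n using Nat.strong_induction_on with
  | _ n ih =>
    intro p q s hn
    by_cases hp : p = []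
    · exact ⟨p, q, s, Conj.refl _, rfl, rfl, Or.inl hp⟩
    by_cases hq : q = []
    · exact ⟨p, q, s, Conj.refl _, rfl, rfl, Or.inr (Or.inl hq)⟩
    by_cases hhd : p.head? = q.head?
    · obtain ⟨x, p1, rfl⟩ := List.exists_cons_of_ne_nil hp
      obtain ⟨y, q1, rfl⟩ := List.exists_cons_of_ne_nil hq
      simp only [List.head?_cons, Option.some.injEq] at hhd
      subst hhd
      obtain ⟨p', q', s', h1, h2, h3, h4⟩ := ih (p1.length + q1.length)
        (by simp at hn; omega) p1 q1 (s ++ [x]) rfl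
      refine ⟨p', q', s', Conj.trans ?_ h1, ?_, ?_, h4⟩
      · refine conj_of (FreeGroup.of x) fun i => ?_
        have hx : ∀ l, toFG (x :: l) = FreeGroup.of x * toFG l := by simp [toFG]
        have hx' : toFG [] = 1 := by simp [toFG]
        fin_cases i <;> simp [mkS, toFG_append, hx, hx'] <;> group
      · rw [h2]; simp; omega
      · rw [h3]; simp; omega
    by_cases hlt : p.getLast? = q.getLast?
    · obtain ⟨p1, x, rfl⟩ := (List.eq_nil_or_concat p).resolve_left hp
      obtain ⟨q1, y, rfl⟩ := (List.eq_nil_or_concat q).resolve_left hq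
      have hlt : x = y := by simpa using hlt
      subst hlt
      obtain ⟨p', q', s', h1, h2, h3, h4⟩ := ih (p1.length + q1.length)
        (by simp at hn; omega) p1 q1 ([x] ++ s) rfl
      refine ⟨p', q', s', by simpa using h1, ?_, ?_, h4⟩
      · rw [h2]; simp
      · rw [h3]; simp
    · exact ⟨p, q, s, Conj.refl _, rfl, rfl, Or.inr (Or.inr ⟨hp, hq, hhd, hlt⟩)⟩

/-- the mirror of `R i`: the other letter `j` maps to `ji`. -/
def R' (i : A2) : Subst := fun j => if j = i then [i] else [j, i]

theorem R'_conj (i : A2) : Conj (R' i) (R i) := by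
  refine conj_of (FreeGroup.of i)⁻¹ fun j => ?_
  by_cases h : j = i <;> simp [R, R', h, toFG]

theorem R'_surj (i : A2) : Function.Surjective (endo (R' i)) := by
  intro x
  have key : (endo (R' i)).range = ⊤ := by
    rw [eq_top_iff, ← FreeGroup.closure_range_of, Subgroup.closure_le]
    rintro _ ⟨j, rfl⟩
    by_cases h : j = i
    · exact ⟨FreeGroup.of j, by erw [endo_of]; simp [R', h, toFG]⟩
    · refine ⟨FreeGroup.of j * (FreeGroup.of i)⁻¹, ?_⟩
      erw [map_mul, map_inv, endo_of, endo_of]; simp [R', h, toFG]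
  have : x ∈ (endo (R' i)).range := by rw [key]; trivial
  exact this

theorem invertible_of_comp_R' {τ : Subst} {i : A2} (h : IsInvertible (comp τ (R' i))) :
    IsInvertible τ := by
  have e : ∀ x, endo (comp τ (R' i)) x = endo τ (endo (R' i) x) := endo_comp τ (R' i)
  constructor
  · intro x y hxy
    obtain ⟨x', rfl⟩ := R'_surj i x
    obtain ⟨y', rfl⟩ := R'_surj i y
    rw [← e, ← e] at hxy
    rw [h.1 hxy]
  · intro y
    obtain ⟨x, hx⟩ := h.2 y
    exact ⟨endo (R' i) x, by rw [← e, hx]⟩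

theorem E_comp_R (i : A2) : comp Esub (R i) = comp (R (1 - i)) Esub := by
  fin_cases i <;> decide

theorem E_comp_E : comp Esub Esub = idS := by decide

theorem E_comp_S (W : List A2) : ∃ V, comp Esub (S W) = comp (S V) Esub := by
  induction W with
  | nil => exact ⟨[], by rw [S, comp_idS, idS_comp]⟩
  | cons i W ih =>
    obtain ⟨V, hV⟩ := ih
    exact ⟨(1 - i) :: V, by rw [S, S, ← comp_assoc, E_comp_R, comp_assoc, hV, comp_assoc]⟩

/-- conjugate to a product of elementary substitutions, possibly followed by the exchange -/
def Good (σ : Subst) : Prop := ∃ W, Conj σ (S W) ∨ Conj σ (comp (S W) Esub)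

theorem Good.conj {σ ρ : Subst} (h : Conj σ ρ) (hρ : Good ρ) : Good σ := by
  obtain ⟨W, h' | h'⟩ := hρ
  · exact ⟨W, Or.inl (h.trans h')⟩
  · exact ⟨W, Or.inr (h.trans h')⟩

theorem Good.comp_R' {τ : Subst} (i : A2) (h : Good τ) : Good (comp τ (R' i)) := by
  obtain ⟨W, h | h⟩ := h
  · refine ⟨W ++ [i], Or.inl ?_⟩
    rw [S_append, S_single]
    exact h.comp (R'_conj i)
  · refine ⟨W ++ [1 - i], Or.inr ?_⟩
    rw [S_append, S_single, comp_assoc, ← E_comp_R, ← comp_assoc]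
    exact h.comp (R'_conj i)

theorem good_of_invertible (n : ℕ) : ∀ σ : Subst, (σ 0).length + (σ 1).length = n →
    NonErasing σ → IsInvertible σ → Good σ := by
  induction n using Nat.strong_induction_on with
  | _ n ih =>
    intro σ hn hne hinv
    obtain ⟨p, q, s, h1, h2, h3, h4⟩ := rotate _ (σ 0) (σ 1) [] rfl
    simp only [List.append_nil, mkS_eta] at h1 h2 h3
    refine Good.conj h1 ?_
    have hinv1 := IsInvertible.conj h1 hinv
    have l0 := List.length_pos_iff.2 (hne 0)
    have l1 := List.length_pos_iff.2 (hne 1)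
    have hneq : mkS (p ++ s) (q ++ s) 0 ≠ mkS (p ++ s) (q ++ s) 1 := by
      intro h
      have h5 : FreeGroup.of (0 : A2) = FreeGroup.of 1 := by
        apply hinv1.1
        rw [endo_of, endo_of, h]
      exact absurd (FreeGroup.of_injective h5) (by decide)
    change p ++ s ≠ q ++ s at hneq
    rcases h4 with rfl | rfl | ⟨hp, hq, hh, hl⟩
    · have hs : s ≠ [] := by rintro rfl; simp at h2; omega
      have hq : q ≠ [] := by rintro rfl; exact hneq rfl
      have e : mkS ([] ++ s) (q ++ s) = comp (mkS s q) (R' 0) := by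
        funext i; fin_cases i <;> simp [mkS, comp, R', apply]
      rw [e] at hinv1 ⊢
      refine Good.comp_R' 0 (ih (s.length + q.length) ?_ _ rfl ?_ (invertible_of_comp_R' hinv1))
      · have := List.length_pos_iff.2 hs
        simp at h2 h3
        omega
      · intro i; fin_cases i
        · exact hs
        · exact hq
    · have hs : s ≠ [] := by rintro rfl; simp at h3; omega
      have hp : p ≠ [] := by rintro rfl; exact hneq rfl
      have e : mkS (p ++ s) ([] ++ s) = comp (mkS p s) (R' 1) := by
        funext i; fin_cases i <;> simp [mkS, comp, R', apply]
      rw [e] at hinv1 ⊢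
      refine Good.comp_R' 1 (ih (p.length + s.length) ?_ _ rfl ?_ (invertible_of_comp_R' hinv1))
      · have := List.length_pos_iff.2 hs
        simp at h2 h3
        omega
      · intro i; fin_cases i
        · exact hp
        · exact hs
    · have hcore := core hinv1.2 ![p, q] s (by intro i; fin_cases i <;> rfl)
        (by intro i; fin_cases i; exacts [hp, hq])
        (by
          intro i j x hi hj
          fin_cases i <;> fin_cases j <;> simp at hi hj ⊢
          · exact hh (hi.trans hj.symm)
          · exact hh (hj.trans hi.symm))
        (by
          intro i j x hi hj
          fin_cases i <;> fin_cases j <;> simp at hi hj ⊢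
          · exact hl (hi.trans hj.symm)
          · exact hl (hj.trans hi.symm))
      generalize mkS (p ++ s) (q ++ s) = τ at hcore
      obtain ⟨i, hi⟩ := hcore 0
      obtain ⟨j, hj⟩ := hcore 1
      fin_cases i <;> fin_cases j
      · simp at hi hj; rw [hi] at hj; simp at hj
      · refine ⟨[], Or.inl ?_⟩
        have : τ = S [] := by
          funext k; fin_cases k
          · exact hi
          · exact hj
        rw [this]; exact Conj.refl _
      · refine ⟨[], Or.inr ?_⟩
        have : τ = comp (S []) Esub := by
          rw [S, idS_comp]
          funext k; fin_cases k
          · exact hj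
          · exact hi
        rw [this]; exact Conj.refl _
      · simp at hi hj; rw [hi] at hj; simp at hj

theorem sq_conj {σ : Subst} (hne : NonErasing σ) (hinv : IsInvertible σ) :
    ∃ W, Conj (substPow σ 2) (S W) := by
  have e : substPow σ 2 = comp σ σ := by rw [substPow_succ, substPow_one]
  rw [e]
  obtain ⟨W, h | h⟩ := good_of_invertible _ σ rfl hne hinv
  · exact ⟨W ++ W, by rw [S_append]; exact h.comp h⟩
  · obtain ⟨V, hV⟩ := E_comp_S W
    refine ⟨W ++ V, ?_⟩
    have : S (W ++ V) = comp (comp (S W) Esub) (comp (S W) Esub) := by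
      rw [S_append, comp_assoc, ← comp_assoc Esub, hV, comp_assoc, E_comp_E, comp_idS]
    rw [this]
    exact h.comp h

end TwoSubst

open TwoSubst in
/-- For primitive invertible substitutions `σ, ρ` on two letters:
`X_σ = X_ρ` if and only if `σ^k ~ ρ^m` for some `k, m ≥ 1`. -/
theorem hull_eq_iff_conj_pow (σ ρ : Subst) (hneσ : NonErasing σ) (hneρ : NonErasing ρ)
    (hσ : Primitive σ) (hρ : Primitive ρ)
    (hiσ : IsInvertible σ) (hiρ : IsInvertible ρ) :
    Hull σ = Hull ρ ↔
      ∃ k m : ℕ, 1 ≤ k ∧ 1 ≤ m ∧ Conj (substPow σ k) (substPow ρ m) := by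
  have pσ := Primitive.prim hσ
  have pρ := Primitive.prim hρ
  rw [hull_eq_iff_lang_eq pσ pρ]
  constructor
  · intro hL
    obtain ⟨W, hW⟩ := sq_conj hneσ hiσ
    obtain ⟨V, hV⟩ := sq_conj hneρ hiρ
    have pσ2 := prim_pow pσ (k := 2) (by norm_num)
    have pρ2 := prim_pow pρ (k := 2) (by norm_num)
    have pW := hW.prim pσ2
    have pV := hV.prim pρ2
    have hne : ∀ W, Prim (S W) → 1 ≤ W.length := by
      intro W pW
      by_contra h0
      have : W = [] := List.length_eq_zero_iff.1 (by omega)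
      subst this
      obtain ⟨n, -, hn⟩ := pW
      have hid : ∀ n, substPow idS n = idS := by
        intro n
        induction n with
        | zero => rfl
        | succ n ih => rw [substPow_succ, ih, comp_idS]
      have := hn 0 1
      rw [S, hid] at this
      simp [idS] at this
    have nW := hne W pW
    have nV := hne V pV
    have hWV : Lang (S W) = Lang (S V) := by
      rw [← hW.lang pσ2, ← hV.lang pρ2, lang_pow pσ (by norm_num), lang_pow pρ (by norm_num), hL]
    have key : (List.replicate V.length W).flatten = (List.replicate W.length V).flatten := by
      refine eq_of_lang (V.length * W.length) _ _ [] (by simp) (by simp [mul_comm]) ?_ ?_ ?_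
      · rw [List.append_nil, S_replicate]; exact prim_pow pW nV
      · rw [List.append_nil, S_replicate]; exact prim_pow pV nW
      · rw [List.append_nil, List.append_nil, S_replicate, S_replicate, lang_pow pW nV,
          lang_pow pV nW, hWV]
    refine ⟨2 * V.length, 2 * W.length, by omega, by omega, ?_⟩
    rw [substPow_mul, substPow_mul]
    have h1 := hW.pow V.length
    have h2 := hV.pow W.length
    rw [← S_replicate] at h1 h2
    rw [key] at h1
    exact h1.trans h2.symm
  · rintro ⟨k, m, hk, hm, h⟩
    rw [← lang_pow pσ hk, ← lang_pow pρ hm]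
    exact h.lang (prim_pow pσ hk)
end

section
/- Let σ be a primitive invertible substitution on the two-letter alphabet 𝒜 = {a,b} with det M_σ = 1. Then the linear map E₁*(σ) maps every finite dual strand onto a finite dual strand: for every finite dual strand γ, there exists a finite dual strand γ' such that E₁*(σ) applied to the element of 𝒢* associated with γ equals the element of 𝒢* associated with γ'. -/
open scoped Matrix

namespace TwoSubst

/-- start of the dual edge -/
def esrc (e : V2 × A2) : V2 := if e.2 = 1 then e.1 else e.1 + eb
/-- end of the dual edge -/
def etgt (e : V2 × A2) : V2 := if e.2 = 1 then e.1 + ea else e.1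

lemma ea_ne : ea ≠ -eb := by
  intro h
  have := congrFun h 0
  simp [ea, eb] at this

lemma flow (N : ℕ) : ∀ (l : Multiset (V2 × A2)) (P Q : V2), l.card = N →
    (l.map fun e => (Finsupp.single (etgt e) (1:ℝ) - Finsupp.single (esrc e) 1 : V2 →₀ ℝ)).sum
      = Finsupp.single Q 1 - Finsupp.single P 1 →
    ∃ γ : ℕ → V2, γ 0 = P ∧ IsDualStrand N γ ∧
      (l.map fun e => (Finsupp.single e (1:ℝ) : Gspace)).sum = strandElem N γ := by
  induction N with
  | zero =>
    intro l P Q hl _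
    rw [Multiset.card_eq_zero] at hl
    subst hl
    exact ⟨fun _ => P, rfl, fun k hk => absurd hk (by omega), by simp [strandElem]⟩
  | succ N ih =>
    intro l P Q hl hb
    have hPQ : P ≠ Q := by
      rintro rfl
      have h1 := congrArg (Finsupp.linearCombination ℝ (fun v : V2 => ((v 0 - v 1 : ℤ) : ℝ))) hb
      rw [sub_self, map_zero, map_multiset_sum, Multiset.map_map] at h1
      have h2 : ∀ e ∈ l, ((Finsupp.linearCombination ℝ (fun v : V2 => ((v 0 - v 1 : ℤ) : ℝ))) ∘
          fun e => (Finsupp.single (etgt e) (1:ℝ) - Finsupp.single (esrc e) 1 : V2 →₀ ℝ)) e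
          = 1 := by
        intro e _
        simp only [Function.comp, map_sub, Finsupp.linearCombination_single, esrc, etgt]
        split_ifs <;> simp [ea, eb]
      rw [Multiset.map_congr rfl h2] at h1
      simp [hl] at h1
      norm_cast at h1
      omega
    have hex : ∃ e ∈ l, esrc e = P := by
      by_contra! hcon
      have h1 := congrArg (Finsupp.applyAddHom P) hb
      rw [map_multiset_sum, Multiset.map_map] at h1
      have h3 : 0 ≤ (Multiset.map ((Finsupp.applyAddHom P) ∘
          fun e => (Finsupp.single (etgt e) (1:ℝ) - Finsupp.single (esrc e) 1 : V2 →₀ ℝ)) l).sum := by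
        apply Multiset.sum_nonneg
        intro x hx
        obtain ⟨e, he, rfl⟩ := Multiset.mem_map.1 hx
        have := hcon e he
        simp only [Function.comp, Finsupp.applyAddHom_apply, Finsupp.sub_apply,
          Finsupp.single_apply, this, if_false]
        split_ifs <;> norm_num
      rw [h1] at h3
      simp [Finsupp.single_apply, hPQ.symm] at h3
      norm_num at h3
    obtain ⟨e, he, heP⟩ := hex
    obtain ⟨l', rfl⟩ := Multiset.exists_cons_of_mem he
    simp only [Multiset.map_cons, Multiset.sum_cons, Multiset.card_cons] at hb hl ⊢
    obtain ⟨γ, h0, hs, hsum⟩ := ih l' (etgt e) Q (by omega) (by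
      rw [heP] at hb
      have := eq_sub_of_add_eq' hb
      rw [this]; abel)
    refine ⟨fun k => Nat.casesOn k P γ, rfl, ?_, ?_⟩
    · rintro (_ | k) hk
      · simp only [h0, ← heP, esrc, etgt]
        split_ifs
        · left; simp
        · right; simp
      · exact hs k (by omega)
    · rw [hsum]
      unfold strandElem
      rw [Finset.sum_range_succ', add_comm]
      congr 1
      obtain ⟨x, i⟩ := e
      have hne := ea_ne
      fin_cases i
      · simp only [h0, ← heP, esrc, etgt]
        simp [hne.symm]
      · simp only [h0, ← heP, esrc, etgt]
        simp

/-- The group ring of `ℤ²`. -/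
abbrev GR := AddMonoidAlgebra ℝ V2

lemma unit_single (f g : GR) (h : f * g = 1) : ∃ P c, f = AddMonoidAlgebra.single P c := by
  classical
  have hf : f ≠ 0 := by rintro rfl; simp at h
  have hg : g ≠ 0 := by rintro rfl; simp at h
  have hfs : f.coeff.support.Nonempty := by
    rw [Finsupp.support_nonempty_iff]; simpa using hf
  have hgs : g.coeff.support.Nonempty := by
    rw [Finsupp.support_nonempty_iff]; simpa using hg
  by_cases hc : f.coeff.support.card = 1
  · obtain ⟨P, c, _, hP⟩ := Finsupp.card_support_eq_one'.1 hc
    refine ⟨P, c, ?_⟩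
    apply AddMonoidAlgebra.coeff_injective
    simpa using hP
  · exfalso
    have h1 := hfs.card_pos
    have h2 := hgs.card_pos
    have : 1 < f.coeff.support.card * g.coeff.support.card := by
      have : 2 ≤ f.coeff.support.card := by omega
      nlinarith
    obtain ⟨p1, m1, p2, m2, hne, u1, u2⟩ := TwoUniqueSums.uniqueAdd_of_one_lt_card this
    have key : ∀ p ∈ f.coeff.support ×ˢ g.coeff.support,
        UniqueAdd f.coeff.support g.coeff.support p.1 p.2 → p.1 + p.2 = 0 := by
      intro p hp hu
      have := AddMonoidAlgebra.coeff_mul_add_of_uniqueAdd hu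
      rw [Finset.mem_product, Finsupp.mem_support_iff, Finsupp.mem_support_iff] at hp
      rw [h, AddMonoidAlgebra.one_def] at this
      by_contra h0
      simp [Finsupp.single_apply, Ne.symm h0] at this
      rcases this with h | h
      · exact hp.1 h
      · exact hp.2 h
    have e1 := key p1 m1 u1
    have e2 := key p2 m2 u2
    rw [Finset.mem_product] at m1 m2
    have := u1 m2.1 m2.2 (by rw [e1, e2])
    exact hne (Prod.ext this.1.symm this.2.symm)

/-- the monomial of `M⁻¹ v` -/
noncomputable def mo (σ : Subst) (v : V2) : GR := AddMonoidAlgebra.single ((M σ)⁻¹.mulVec v) 1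

lemma mo_add (σ : Subst) (v w : V2) : mo σ (v + w) = mo σ v * mo σ w := by
  simp [mo, Matrix.mulVec_add]

lemma mo_zero (σ : Subst) : mo σ 0 = 1 := by
  simp [mo, AddMonoidAlgebra.one_def]

/-- suffix Fox derivative -/
noncomputable def DL (σ : Subst) : List A2 → A2 → GR
  | [] => 0
  | x :: w => DL σ w + Pi.single x (mo σ (Avec w))

lemma Avec_nil : Avec [] = 0 := by ext i; simp [Avec]

lemma Avec_cons (x : A2) (w : List A2) : Avec (x :: w) = Avec w + Avec [x] := by
  ext i; simp [Avec, List.count_cons]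

lemma fund (σ : Subst) (w : List A2) :
    DL σ w 0 * (mo σ (Avec [0]) - 1) + DL σ w 1 * (mo σ (Avec [1]) - 1) = mo σ (Avec w) - 1 := by
  induction w with
  | nil => simp [DL, Avec_nil, mo_zero]
  | cons x w ih =>
    rw [Avec_cons x w, mo_add]
    fin_cases x
    · simp [DL]
      linear_combination ih
    · simp [DL]
      linear_combination ih

/-- augmentation -/
noncomputable def aug : GR →ₐ[ℝ] ℝ := AddMonoidAlgebra.lift ℝ ℝ V2 1

lemma aug_single (v : V2) (c : ℝ) : aug (AddMonoidAlgebra.single v c) = c := by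
  simp [aug]

lemma aug_DL (σ : Subst) (w : List A2) (i : A2) : aug (DL σ w i) = w.count i := by
  induction w with
  | nil => simp [DL]
  | cons x w ih =>
    simp only [DL, Pi.add_apply, map_add, ih, List.count_cons]
    by_cases h : x = i
    · subst h; simp [mo, aug_single]
    · simp [h, Pi.single_eq_of_ne (Ne.symm h)]

/-- affine action of a letter -/
noncomputable def pm (σ : Subst) (i : A2) : Equiv.Perm (A2 → GR) where
  toFun f := mo σ (Avec [i]) • f + Pi.single i 1
  invFun f := mo σ (-Avec [i]) • (f - Pi.single i 1)
  left_inv f := by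
    simp [smul_smul, ← mo_add, mo_zero]
  right_inv f := by
    simp [smul_smul, ← mo_add, mo_zero]

/-- action of the free group -/
noncomputable def act (σ : Subst) : FreeGroup A2 →* Equiv.Perm (A2 → GR) :=
  FreeGroup.lift fun i => (pm σ i)⁻¹

lemma act_word (σ : Subst) (w : List A2) (f : A2 → GR) :
    (act σ (toFG w))⁻¹ f = mo σ (Avec w) • f + DL σ w := by
  induction w generalizing f with
  | nil => simp [toFG, Avec_nil, mo_zero, DL]
  | cons x w ih =>
    have : toFG (x :: w) = FreeGroup.of x * toFG w := by simp [toFG]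
    rw [this, map_mul, mul_inv_rev, Equiv.Perm.mul_apply]
    have h2 : (act σ (FreeGroup.of x))⁻¹ = pm σ x := by simp [act]
    rw [h2, ih, Avec_cons, mo_add]
    simp only [pm, Equiv.coe_fn_mk, DL, smul_add, smul_smul]
    have : mo σ (Avec w) • (Pi.single x 1 : A2 → GR) = Pi.single x (mo σ (Avec w)) := by
      rw [← Pi.single_smul]; simp
    rw [this]; abel

/-- stabiliser of a submodule -/
def stab (S : Submodule GR (A2 → GR)) : Subgroup (Equiv.Perm (A2 → GR)) where
  carrier := {π | ∀ f, π f ∈ S ↔ f ∈ S}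
  mul_mem' := by
    intro a b ha hb f
    rw [Equiv.Perm.mul_apply, ha, hb]
  one_mem' := by intro f; simp
  inv_mem' := by
    intro a ha f
    rw [← ha]
    simp

lemma single_mem (σ : Subst) (hinv : IsInvertible σ) (i : A2) :
    (Pi.single i 1 : A2 → GR) ∈ Submodule.span GR {DL σ (σ 0), DL σ (σ 1)} := by
  set S := Submodule.span GR {DL σ (σ 0), DL σ (σ 1)} with hS
  have hD : ∀ j, DL σ (σ j) ∈ S := by
    intro j
    apply Submodule.subset_span
    fin_cases j <;> simp
  have hw : ∀ j, act σ (toFG (σ j)) ∈ stab S := by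
    intro j
    rw [← Subgroup.inv_mem_iff]
    intro f
    rw [act_word, S.add_mem_iff_left (hD j)]
    constructor
    · intro h
      have := S.smul_mem (mo σ (-Avec (σ j))) h
      simpa [smul_smul, ← mo_add, mo_zero] using this
    · exact S.smul_mem _
  have hall : ∀ y, act σ (endo σ y) ∈ stab S := by
    intro y
    induction y using FreeGroup.induction_on with
    | C1 => simp [one_mem]
    | of x => rw [show endo σ (FreeGroup.of x) = toFG (σ x) from FreeGroup.lift_apply_of]; exact hw x
    | inv_of x h => rw [map_inv, map_inv]; exact inv_mem h
    | mul x y hx hy => rw [map_mul, map_mul]; exact mul_mem hx hy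
  obtain ⟨y, hy⟩ := hinv.2 (FreeGroup.of i)
  have h := hall y
  rw [hy, ← Subgroup.inv_mem_iff] at h
  have h2 : (act σ (FreeGroup.of i))⁻¹ = pm σ i := by simp [act]
  rw [h2] at h
  have := (h 0).2 S.zero_mem
  simpa [pm] using this

lemma det_mono (σ : Subst) (hinv : IsInvertible σ) (hdet : (M σ).det = 1) :
    ∃ P : V2, DL σ (σ 0) 0 * DL σ (σ 1) 1 - DL σ (σ 0) 1 * DL σ (σ 1) 0
      = AddMonoidAlgebra.single P 1 := by
  obtain ⟨a, b, h0⟩ := Submodule.mem_span_pair.1 (single_mem σ hinv 0)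
  obtain ⟨c, d, h1⟩ := Submodule.mem_span_pair.1 (single_mem σ hinv 1)
  have h00 := congrFun h0 0
  have h01 := congrFun h0 1
  have h10 := congrFun h1 0
  have h11 := congrFun h1 1
  simp at h00 h01 h10 h11
  obtain ⟨P, r, hP⟩ := unit_single
    (DL σ (σ 0) 0 * DL σ (σ 1) 1 - DL σ (σ 0) 1 * DL σ (σ 1) 0) (a * d - b * c) (by
      have : (a * DL σ (σ 0) 0 + b * DL σ (σ 1) 0) * (c * DL σ (σ 0) 1 + d * DL σ (σ 1) 1)
        - (a * DL σ (σ 0) 1 + b * DL σ (σ 1) 1) * (c * DL σ (σ 0) 0 + d * DL σ (σ 1) 0) = 1 := by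
        rw [h00, h01, h10, h11]; ring
      rw [← this]; ring)
  refine ⟨P, ?_⟩
  have hr := congrArg aug hP
  rw [aug_single, map_sub, map_mul, map_mul, aug_DL, aug_DL, aug_DL, aug_DL] at hr
  rw [Matrix.det_fin_two] at hdet
  simp only [M] at hdet
  have hdet' : (((σ 0).count 0 : ℝ) * (σ 1).count 1 - (σ 1).count 0 * (σ 0).count 1) = 1 := by
    exact_mod_cast hdet
  rw [hP]
  congr 1
  linarith

/-- boundary -/
noncomputable def bd : Gspace →ₗ[ℝ] GR :=
  Finsupp.lift GR ℝ (V2 × A2) fun e =>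
    AddMonoidAlgebra.single (etgt e) 1 - AddMonoidAlgebra.single (esrc e) 1

lemma bd_single (e : V2 × A2) : bd (Finsupp.single e 1) =
    AddMonoidAlgebra.single (etgt e) 1 - AddMonoidAlgebra.single (esrc e) 1 := by
  simp [bd]

/-- boundary factor -/
noncomputable def dl (j : A2) : GR :=
  AddMonoidAlgebra.single (etgt (0, j)) 1 - AddMonoidAlgebra.single (esrc (0, j)) 1

lemma bd_mo (σ : Subst) (v : V2) (j : A2) :
    bd (Finsupp.single ((M σ)⁻¹.mulVec v, j) 1) = mo σ v * dl j := by
  rw [bd_single]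
  fin_cases j <;> simp [dl, mo, esrc, etgt, mul_sub]

lemma bd_word (σ : Subst) (W : V2) (i j d : A2) (w : List A2) :
    bd (∑ k ∈ Finset.range w.length, if w.getD k d = i then
      Finsupp.single ((M σ)⁻¹.mulVec (W + Avec (w.drop (k + 1))), j) (1 : ℝ) else 0)
    = mo σ W * DL σ w i * dl j := by
  induction w with
  | nil => simp [DL]
  | cons x w ih =>
    rw [List.length_cons, Finset.sum_range_succ', map_add]
    simp only [List.getD_cons_succ, List.drop_succ_cons, List.getD_cons_zero, List.drop_zero] at ih ⊢
    rw [ih]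
    simp only [DL, Pi.add_apply]
    by_cases h : x = i
    · subst h
      rw [if_pos rfl, bd_mo, mo_add, Pi.single_eq_same]; ring
    · simp [h, Pi.single_eq_of_ne (Ne.symm h)]

lemma bd_basis (σ : Subst) (W : V2) (i : A2) :
    bd (E1star σ (Finsupp.single (W, i) 1)) =
      mo σ W * (DL σ (σ 0) i * dl 0 + DL σ (σ 1) i * dl 1) := by
  have : E1star σ (Finsupp.single (W, i) 1) = E1starBasis σ (W, i) := by simp [E1star]
  rw [this, E1starBasis, map_sum, Fin.sum_univ_two, bd_word, bd_word]
  ring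

lemma mo_word (σ : Subst) (hdet : (M σ).det = 1) (j : A2) :
    mo σ (Avec (σ j)) = AddMonoidAlgebra.single (Avec [j]) 1 := by
  have : Avec (σ j) = (M σ).mulVec (Avec [j]) := by
    ext i
    fin_cases j <;> simp [Matrix.mulVec, dotProduct, Fin.sum_univ_two, Avec, M]
  rw [mo, this, Matrix.mulVec_mulVec, Matrix.nonsing_inv_mul _ (by rw [hdet]; exact isUnit_one),
    Matrix.one_mulVec]

lemma Avec0 : Avec [0] = ea := by ext i; fin_cases i <;> simp [Avec, ea]
lemma Avec1 : Avec [1] = eb := by ext i; fin_cases i <;> simp [Avec, eb]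

lemma bd_edge (σ : Subst) (hdet : (M σ).det = 1) (P : V2)
    (hP : DL σ (σ 0) 0 * DL σ (σ 1) 1 - DL σ (σ 0) 1 * DL σ (σ 1) 0
      = AddMonoidAlgebra.single P 1) (e : V2 × A2) :
    bd (E1star σ (Finsupp.single e 1)) =
      AddMonoidAlgebra.single P 1 * (mo σ (etgt e) - mo σ (esrc e)) := by
  obtain ⟨W, i⟩ := e
  have f0 := fund σ (σ 0)
  have f1 := fund σ (σ 1)
  rw [mo_word σ hdet, Avec0, Avec1] at f0 f1
  have d0 : dl 0 = 1 - AddMonoidAlgebra.single eb 1 := by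
    simp [dl, etgt, esrc, AddMonoidAlgebra.one_def]
  have d1 : dl 1 = AddMonoidAlgebra.single ea 1 - 1 := by
    simp [dl, etgt, esrc, AddMonoidAlgebra.one_def]
  rw [bd_basis, d0, d1, ← hP]
  fin_cases i
  · simp [esrc, etgt, mo_add]
    linear_combination (-mo σ W * DL σ (σ 1) 0) * f0 + (mo σ W * DL σ (σ 0) 0) * f1
  · simp [esrc, etgt, mo_add]
    linear_combination (-mo σ W * DL σ (σ 1) 1) * f0 + (mo σ W * DL σ (σ 0) 1) * f1

/-- sums of edges -/
def IsES (g : Gspace) : Prop :=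
  ∃ l : Multiset (V2 × A2), g = (l.map fun e => (Finsupp.single e (1:ℝ) : Gspace)).sum

lemma IsES.zero : IsES 0 := ⟨0, by simp⟩

lemma IsES.add (g h : Gspace) : IsES g → IsES h → IsES (g + h) := by
  rintro ⟨l, rfl⟩ ⟨l', rfl⟩
  exact ⟨l + l', by simp⟩

lemma IsES.one (e : V2 × A2) : IsES (Finsupp.single e 1) := ⟨{e}, by simp⟩

lemma IsES.basis (σ : Subst) (e : V2 × A2) : IsES (E1star σ (Finsupp.single e 1)) := by
  have : E1star σ (Finsupp.single e 1) = E1starBasis σ e := by simp [E1star]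
  rw [this, E1starBasis]
  refine Finset.sum_induction _ IsES IsES.add IsES.zero fun j _ => ?_
  refine Finset.sum_induction _ IsES IsES.add IsES.zero fun k _ => ?_
  split_ifs
  · exact IsES.one _
  · exact IsES.zero

/-- the `k`-th edge of a strand -/
def sedge (γ : ℕ → V2) (k : ℕ) : V2 × A2 :=
  if γ (k + 1) - γ k = ea then (γ k, 1) else (γ (k + 1), 0)

lemma strand_eq (n : ℕ) (γ : ℕ → V2) :
    strandElem n γ = ∑ k ∈ Finset.range n, Finsupp.single (sedge γ k) (1:ℝ) := by
  unfold strandElem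
  refine Finset.sum_congr rfl fun k _ => ?_
  unfold sedge
  split_ifs <;> rfl

lemma sedge_ends (n : ℕ) (γ : ℕ → V2) (h : IsDualStrand n γ) (k : ℕ) (hk : k < n) :
    esrc (sedge γ k) = γ k ∧ etgt (sedge γ k) = γ (k + 1) := by
  unfold sedge
  split_ifs with h1
  · simp [esrc, etgt, ← h1]
  · have h2 := (h k hk).resolve_left h1
    have h3 : eb = -(γ (k + 1) - γ k) := by rw [h2, neg_neg]
    simp [esrc, etgt, h3]

theorem mainlem (σ : Subst) (hinv : IsInvertible σ) (hdet : (M σ).det = 1)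
    (n : ℕ) (γ : ℕ → V2) (hγ : IsDualStrand n γ) :
    ∃ (m : ℕ) (γ' : ℕ → V2), IsDualStrand m γ' ∧
        E1star σ (strandElem n γ) = strandElem m γ' := by
  obtain ⟨P, hP⟩ := det_mono σ hinv hdet
  have hES : IsES (E1star σ (strandElem n γ)) := by
    rw [strand_eq, map_sum]
    exact Finset.sum_induction _ IsES IsES.add IsES.zero fun k _ => IsES.basis σ _
  have hbd : bd (E1star σ (strandElem n γ)) =
      AddMonoidAlgebra.single P 1 * (mo σ (γ n) - mo σ (γ 0)) := by
    rw [strand_eq, map_sum, map_sum, ← Finset.sum_range_sub (fun k => mo σ (γ k)), Finset.mul_sum]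
    refine Finset.sum_congr rfl fun k hk => ?_
    obtain ⟨h1, h2⟩ := sedge_ends n γ hγ k (Finset.mem_range.1 hk)
    rw [bd_edge σ hdet P hP, h1, h2]
  obtain ⟨l, hl⟩ := hES
  rw [hl] at hbd ⊢
  have hfl := congrArg (AddMonoidAlgebra.coeffAddEquiv) hbd
  rw [map_multiset_sum, map_multiset_sum, Multiset.map_map, Multiset.map_map] at hfl
  obtain ⟨γ', _, h1, h2⟩ := flow l.card l (P + (M σ)⁻¹.mulVec (γ 0)) (P + (M σ)⁻¹.mulVec (γ n)) rfl (by
    convert hfl using 3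
    · simp [Function.comp, bd_single]
    · simp [mo, mul_sub])
  exact ⟨_, γ', h1, h2⟩

end TwoSubst

open TwoSubst in
/-- For a primitive invertible substitution `σ` on two letters with
`det M_σ = 1`, the dual map `E₁*(σ)` maps every finite dual strand onto a finite dual
strand. -/
theorem E1star_maps_dualStrands (σ : Subst) (hne : NonErasing σ)
    (hprim : Primitive σ) (hinv : IsInvertible σ) (hdet : (M σ).det = 1) :
    ∀ (n : ℕ) (γ : ℕ → V2), IsDualStrand n γ →
      ∃ (m : ℕ) (γ' : ℕ → V2), IsDualStrand m γ' ∧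
        E1star σ (strandElem n γ) = strandElem m γ' := by
  exact fun n γ hγ => mainlem σ hinv hdet n γ hγ
end

section
/- Let σ be an invertible substitution on the two-letter alphabet 𝒜 = {a,b} whose substitution matrix M_σ has determinant +1. Then the reciprocal σ̄ := τ_a ∘ σ⁻¹ ∘ τ_a⁻¹ is again a substitution on {a,b}, i.e., σ̄ maps a and b to nonempty positive words in a and b (equivalently, σ⁻¹ is a substitution on the alphabet {a⁻¹, b}); its substitution matrix satisfies M_{σ̄} = D · M_σ⁻¹ · D with D = [[−1,0],[0,1]], and hence E_M · M_{σ̄} · E_M = M_σᵀ with E_M = [[0,1],[1,0]]. Moreover, if σ is primitive then σ̄ is primitive. -/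
open scoped Matrix

open scoped Matrix

namespace RecipAux
open TwoSubst

/-- `u`, `v` generate the free group. -/
def Gen (u v : List A2) : Prop :=
  ∀ H : Subgroup (FreeGroup A2), toFG u ∈ H → toFG v ∈ H → ∀ x, x ∈ H

def PP (u v : List A2) : Prop :=
  ∃ p s x y, x ≠ y ∧ u ++ v = p ++ x :: y :: s ∧ v ++ u = p ++ y :: x :: s

lemma toFG_append (u v : List A2) : toFG (u ++ v) = toFG u * toFG v := by
  simp [toFG]

lemma toFG_cons (c : A2) (v : List A2) : toFG (c :: v) = FreeGroup.of c * toFG v := by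
  simp [toFG]

lemma Gen.symm {u v : List A2} (h : Gen u v) : Gen v u := fun H a b => h H b a

lemma not_comm {u v : List A2} (h : Gen u v) : u ++ v ≠ v ++ u := by
  intro e
  have e' : toFG u * toFG v = toFG v * toFG u := by rw [← toFG_append, e, toFG_append]
  have h1 := h (Subgroup.centralizer {toFG u})
    (by simp [Subgroup.mem_centralizer_iff]) (by simpa [Subgroup.mem_centralizer_iff] using e')
  have h2 := h (Subgroup.centralizer {toFG v})
    (by simpa [Subgroup.mem_centralizer_iff] using e'.symm) (by simp [Subgroup.mem_centralizer_iff])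
  have h3 := h (Subgroup.center _)
    (by rw [Subgroup.mem_center_iff]; intro g
        have := h1 g; rw [Subgroup.mem_centralizer_iff] at this
        exact (this _ rfl).symm)
    (by rw [Subgroup.mem_center_iff]; intro g
        have := h2 g; rw [Subgroup.mem_centralizer_iff] at this
        exact (this _ rfl).symm)
  have h4 := Subgroup.mem_center_iff.1 (h3 (FreeGroup.of 0)) (FreeGroup.of 1)
  have h5 := congrArg FreeGroup.toWord h4
  revert h5
  decide

lemma exists_diff : ∀ (u v : List A2), u.length = v.length → u ≠ v →
    ∃ p x y t t', x ≠ y ∧ u = p ++ x :: t ∧ v = p ++ y :: t'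
  | [], [], _, h => absurd rfl h
  | [], _ :: _, h, _ => by simp at h
  | _ :: _, [], h, _ => by simp at h
  | c :: u, d :: v, h, hn => by
    by_cases hcd : c = d
    · subst hcd
      obtain ⟨p, x, y, t, t', h1, h2, h3⟩ := exists_diff u v (by simpa using h) (by simpa using hn)
      exact ⟨c :: p, x, y, t, t', h1, by simp [h2], by simp [h3]⟩
    · exact ⟨[], c, d, u, v, hcd, rfl, rfl⟩

/-- The folded-graph argument. -/
lemma base_case {c d : A2} {u v : List A2} (hcd : c ≠ d) (h : Gen (c :: u) (d :: v))
    (h1 : ¬ (c :: u) <:+ (d :: v)) (h2 : ¬ (d :: v) <:+ (c :: u)) : u = [] ∧ v = [] := by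
  classical
  let S : Finset (List A2) := ((c :: u).tails ++ (d :: v).tails).toFinset
  have hS : ∀ w, w ∈ S ↔ w <:+ (c :: u) ∨ w <:+ (d :: v) := by
    intro w; simp only [S, List.mem_toFinset, List.mem_append, List.mem_tails]
  let V := {w // w ∈ S}
  let O : V := ⟨[], by rw [hS]; simp⟩
  let f : A2 → V → V := fun e w =>
    if hw : e :: w.1 ∈ S then
      if e :: w.1 = c :: u ∨ e :: w.1 = d :: v then O else ⟨e :: w.1, hw⟩
    else O
  have key : ∀ e : A2, ∃ g : Equiv.Perm V, ∀ w : V, e :: w.1 ∈ S → g w = f e w := by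
    intro e
    obtain ⟨g, hg⟩ := Finset.exists_equiv_extend_of_card_eq (α := V) (β := V)
      (t := Finset.univ) (by simp) (s := Finset.univ.filter fun w : V => e :: w.1 ∈ S)
      (f := f e) (by simp) (by
        intro w hw w' hw' hh
        simp only [Finset.coe_filter, Finset.mem_univ, true_and, Set.mem_ofPred_eq] at hw hw'
        simp only [f, hw, hw', dif_pos, O] at hh
        apply Subtype.ext
        split_ifs at hh with a1 a2 a2
        · rcases a1 with a1 | a1 <;> rcases a2 with a2 | a2 <;> simp at a1 a2 <;> grind
        · exact absurd (congrArg Subtype.val hh) (by simp)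
        · exact absurd (congrArg Subtype.val hh) (by simp)
        · have := congrArg Subtype.val hh
          simpa using this)
    refine ⟨g.trans (Equiv.subtypeUnivEquiv (by simp)), fun w hw => ?_⟩
    exact hg w (by simpa using hw)
  choose g hg using key
  let F : FreeGroup A2 →* Equiv.Perm V := FreeGroup.lift g
  have walk : ∀ w : List A2, ∀ hw : w ∈ S, w ≠ c :: u → w ≠ d :: v →
      F (toFG w) O = ⟨w, hw⟩ := by
    intro w
    induction w with
    | nil => intro hw _ _; simp [toFG, O]
    | cons e w ih =>
      intro hw n1 n2
      have hwS : w ∈ S := by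
        rw [hS] at hw ⊢
        exact hw.imp (fun h => (List.suffix_cons e w).trans h)
          (fun h => (List.suffix_cons e w).trans h)
      have m1 : w ≠ c :: u := by
        rintro rfl
        rcases (hS _).1 hw with h | h
        · have := h.length_le; simp at this
        · exact h1 ((List.suffix_cons e _).trans h)
      have m2 : w ≠ d :: v := by
        rintro rfl
        rcases (hS _).1 hw with h | h
        · exact h2 ((List.suffix_cons e _).trans h)
        · have := h.length_le; simp at this
      rw [toFG_cons, map_mul, Equiv.Perm.mul_apply, ih hwS m1 m2]
      simp only [F, FreeGroup.lift_apply_of]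
      rw [hg e _ hw]
      simp only [f, hw, dif_pos]
      rw [if_neg (by simp only [not_or]; exact ⟨n1, n2⟩)]
  have huS : u ∈ S := by rw [hS]; left; exact List.suffix_cons c u
  have hvS : v ∈ S := by rw [hS]; right; exact List.suffix_cons d v
  have hu1 : F (toFG u) O = ⟨u, huS⟩ := by
    apply walk
    · intro h; simpa using congrArg List.length h
    · rintro rfl; exact h2 (List.suffix_cons c _)
  have hv1 : F (toFG v) O = ⟨v, hvS⟩ := by
    apply walk
    · rintro rfl; exact h1 (List.suffix_cons d _)
    · intro h; simpa using congrArg List.length h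
  have gu : g c ⟨u, huS⟩ = O := by
    have : c :: u ∈ S := by rw [hS]; left; exact List.suffix_refl _
    rw [hg c _ this]; simp only [f, this, dif_pos]; simp
  have gv : g d ⟨v, hvS⟩ = O := by
    have : d :: v ∈ S := by rw [hS]; right; exact List.suffix_refl _
    rw [hg d _ this]; simp only [f, this, dif_pos]; simp
  have all := h ((MulAction.stabilizer (Equiv.Perm V) O).comap F)
    (by rw [Subgroup.mem_comap, MulAction.mem_stabilizer_iff, toFG_cons, map_mul,
          Equiv.Perm.smul_def, Equiv.Perm.mul_apply, hu1]
        simpa [F] using gu)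
    (by rw [Subgroup.mem_comap, MulAction.mem_stabilizer_iff, toFG_cons, map_mul,
          Equiv.Perm.smul_def, Equiv.Perm.mul_apply, hv1]
        simpa [F] using gv)
  have fixO : ∀ e, g e O = O := by
    intro e
    have := all (FreeGroup.of e)
    rw [Subgroup.mem_comap, MulAction.mem_stabilizer_iff, Equiv.Perm.smul_def] at this
    simpa [F] using this
  constructor
  · have := (g c).injective (gu.trans (fixO c).symm)
    exact congrArg Subtype.val this
  · have := (g d).injective (gv.trans (fixO d).symm)
    exact congrArg Subtype.val this

lemma gen_conj {c : A2} {u v : List A2} (h : Gen (c :: u) (c :: v)) :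
    Gen (u ++ [c]) (v ++ [c]) := by
  intro H hu hv x
  have hc : toFG [c] = FreeGroup.of c := by simp [toFG]
  have := h (H.comap (MulAut.conj (FreeGroup.of c)⁻¹).toMonoidHom)
    (by simpa [toFG_cons, toFG_append, hc, mul_assoc] using hu)
    (by simpa [toFG_cons, toFG_append, hc, mul_assoc] using hv)
    (FreeGroup.of c * x * (FreeGroup.of c)⁻¹)
  simpa [mul_assoc] using this

lemma gen_prefix {u v : List A2} (h : Gen u (u ++ v)) : Gen u v :=
  fun H hu hv => h H hu (by rw [toFG_append]; exact H.mul_mem hu hv)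

lemma gen_suffix {u v : List A2} (h : Gen u (v ++ u)) : Gen u v :=
  fun H hu hv => h H hu (by rw [toFG_append]; exact H.mul_mem hv hu)

lemma PP.symm {u v : List A2} (h : PP u v) : PP v u := by
  obtain ⟨p, s, x, y, hxy, h1, h2⟩ := h
  exact ⟨p, s, y, x, hxy.symm, h2, h1⟩

lemma PP.suffix {u v : List A2} (h : PP u v) : PP u (v ++ u) := by
  obtain ⟨p, s, x, y, hxy, h1, h2⟩ := h
  exact ⟨p, s ++ u, x, y, hxy, by rw [← List.append_assoc, h1]; simp, by rw [h2]; simp⟩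

lemma PP.conj {c : A2} {u v : List A2} (h : PP (u ++ [c]) (v ++ [c])) :
    PP (c :: u) (c :: v) := by
  obtain ⟨p, s, x, y, hxy, h1, h2⟩ := h
  rcases List.eq_nil_or_concat s with rfl | ⟨s', e, rfl⟩
  · exfalso
    have a1 : (u ++ [c] ++ v) ++ [c] = (p ++ [x]) ++ [y] := by simpa using h1
    have a2 : (v ++ [c] ++ u) ++ [c] = (p ++ [y]) ++ [x] := by simpa using h2
    have b1 := (List.append_inj' a1 rfl).2
    have b2 := (List.append_inj' a2 rfl).2
    exact hxy (by simpa using b2.symm.trans b1)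
  · have a1 : (u ++ [c] ++ v) ++ [c] = (p ++ x :: y :: s') ++ [e] := by simpa using h1
    have a2 : (v ++ [c] ++ u) ++ [c] = (p ++ y :: x :: s') ++ [e] := by simpa using h2
    have b1 := (List.append_inj' a1 rfl).1
    have b2 := (List.append_inj' a2 rfl).1
    exact ⟨c :: p, s', x, y, hxy, by simpa using b1, by simpa using b2⟩

lemma pp_of_gen : ∀ (n : ℕ) (u v : List A2), u.length + v.length ≤ n → Gen u v → PP u v := by
  intro n
  induction n with
  | zero =>
    intro u v hn h
    exfalso
    have hu : u = [] := List.eq_nil_of_length_eq_zero (by omega)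
    have hv : v = [] := List.eq_nil_of_length_eq_zero (by omega)
    exact not_comm h (by simp [hu, hv])
  | succ n ih =>
    have inner : ∀ (p u v : List A2) (x y : A2) (t t' : List A2), x ≠ y →
        u ++ v = p ++ x :: t → v ++ u = p ++ y :: t' → u.length + v.length ≤ n + 1 →
        Gen u v → PP u v := by
      intro p
      induction p with
      | nil =>
        intro u v x y t t' hxy e1 e2 hn h
        cases u with
        | nil => exact absurd (by simp) (not_comm h)
        | cons c u =>
        cases v with
        | nil => exact absurd (by simp) (not_comm h)
        | cons d v =>
        have hcd : c ≠ d := by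
          simp at e1 e2
          rw [e1.1, e2.1]; exact hxy
        by_cases s1 : (c :: u) <:+ (d :: v)
        · obtain ⟨w, hw⟩ := s1
          rw [← hw] at h hn ⊢
          exact (ih _ _ (by simp at hn ⊢; omega) (gen_suffix h)).suffix
        by_cases s2 : (d :: v) <:+ (c :: u)
        · obtain ⟨w, hw⟩ := s2
          rw [← hw] at h hn ⊢
          exact (ih _ _ (by simp at hn ⊢; omega) (gen_suffix h.symm)).suffix.symm
        obtain ⟨rfl, rfl⟩ := base_case hcd h s1 s2
        exact ⟨[], [], c, d, hcd, rfl, rfl⟩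
      | cons e p ihp =>
        intro u v x y t t' hxy e1 e2 hn h
        cases u with
        | nil => exact absurd (by simp) (not_comm h)
        | cons c u =>
        cases v with
        | nil => exact absurd (by simp) (not_comm h)
        | cons d v =>
        simp only [List.cons_append, List.cons.injEq] at e1 e2
        obtain ⟨rfl, e1⟩ := e1
        obtain ⟨rfl, e2⟩ := e2
        apply PP.conj
        refine ihp _ _ x y (t ++ [d]) (t' ++ [d]) hxy ?_ ?_ ?_ (gen_conj h)
        · have := congrArg (· ++ [d]) e1
          simpa using this
        · have := congrArg (· ++ [d]) e2
          simpa using this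
        · simp at hn ⊢; omega
    intro u v hn h
    obtain ⟨p, x, y, t, t', hxy, e1, e2⟩ :=
      exists_diff (u ++ v) (v ++ u) (by simp; omega) (not_comm h)
    exact inner p u v x y t t' hxy e1 e2 hn h

lemma PP.cases {u v : List A2} (h : PP u v) (hl : u.length ≤ v.length) :
    u <+: v ∨ u <:+ v ∨ (u.length = 1 ∧ v.length = 1) := by
  obtain ⟨p, s, x, y, hxy, h1, h2⟩ := h
  have L := congrArg List.length h1
  simp at L
  by_cases hp : u.length ≤ p.length
  · left
    have a1 : u <+: p := List.prefix_of_prefix_length_le (List.prefix_append u v)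
      (h1 ▸ List.prefix_append p _) hp
    have a2 : p <+: v ++ u := h2 ▸ List.prefix_append p _
    exact List.prefix_of_prefix_length_le (a1.trans a2) (List.prefix_append v u) hl
  by_cases hs : u.length ≤ s.length
  · right; left
    have b1 : s <:+ v ++ u := ⟨p ++ [y, x], by rw [h2]; simp⟩
    have b2 : s <:+ u ++ v := ⟨p ++ [x, y], by rw [h1]; simp⟩
    have a1 : u <:+ s := List.suffix_of_suffix_length_le (List.suffix_append v u) b1 hs
    exact List.suffix_of_suffix_length_le (a1.trans b2) (List.suffix_append u v) hl
  · right; right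
    have k1 : u ++ v = (p ++ [x]) ++ (y :: s) := by rw [h1]; simp
    have k2 : v ++ u = (p ++ [y]) ++ (x :: s) := by rw [h2]; simp
    have c1 := List.append_inj k1 (by simp; omega)
    have c2 := List.append_inj k2 (by simp; omega)
    cases p with
    | nil => simp [c1.1, c2.1]
    | cons e p =>
      exfalso
      have d1 := c1.1.symm.trans c2.2
      have d2 := c2.1.symm.trans c1.2
      simp at d1 d2
      exact hxy (d1.1.symm.trans d2.1)

lemma main_mem : ∀ (n : ℕ) (u v : List A2), u.length + v.length ≤ n → Gen u v →
    (u.count 0 : ℤ) * v.count 1 - (v.count 0 : ℤ) * u.count 1 = 1 →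
    (FreeGroup.of (0 : A2))⁻¹ ∈ Submonoid.closure {(toFG u)⁻¹, toFG v} ∧
      FreeGroup.of (1 : A2) ∈ Submonoid.closure {(toFG u)⁻¹, toFG v} := by
  intro n
  induction n with
  | zero =>
    intro u v hn h
    exfalso
    have hu : u = [] := List.eq_nil_of_length_eq_zero (by omega)
    have hv : v = [] := List.eq_nil_of_length_eq_zero (by omega)
    exact not_comm h (by simp [hu, hv])
  | succ n ih =>
    intro u v hn h hd
    have hu : 0 < u.length := by
      rcases u with _ | _
      · exact absurd (by simp) (not_comm h)
      · simp
    have hv : 0 < v.length := by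
      rcases v with _ | _
      · exact absurd (by simp) (not_comm h)
      · simp
    have hP := pp_of_gen _ u v le_rfl h
    have step : ∀ u' v' : List A2, (toFG u')⁻¹ ∈ Submonoid.closure {(toFG u)⁻¹, toFG v} →
        toFG v' ∈ Submonoid.closure {(toFG u)⁻¹, toFG v} → u'.length + v'.length ≤ n →
        Gen u' v' → (u'.count 0 : ℤ) * v'.count 1 - (v'.count 0 : ℤ) * u'.count 1 = 1 →
        (FreeGroup.of (0 : A2))⁻¹ ∈ Submonoid.closure {(toFG u)⁻¹, toFG v} ∧
      FreeGroup.of (1 : A2) ∈ Submonoid.closure {(toFG u)⁻¹, toFG v} := by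
      intro u' v' m1 m2 hl hg hdd
      have hle : Submonoid.closure {(toFG u')⁻¹, toFG v'} ≤
          Submonoid.closure {(toFG u)⁻¹, toFG v} := by
        rw [Submonoid.closure_le]
        rintro z (rfl | rfl)
        · exact m1
        · exact m2
      obtain ⟨q1, q2⟩ := ih u' v' hl hg hdd
      exact ⟨hle q1, hle q2⟩
    have mu : (toFG u)⁻¹ ∈ Submonoid.closure {(toFG u)⁻¹, toFG v} :=
      Submonoid.subset_closure (by simp)
    have mv : toFG v ∈ Submonoid.closure {(toFG u)⁻¹, toFG v} :=
      Submonoid.subset_closure (by simp)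
    have hbase : u.length = 1 → v.length = 1 →
        (FreeGroup.of (0 : A2))⁻¹ ∈ Submonoid.closure {(toFG u)⁻¹, toFG v} ∧
      FreeGroup.of (1 : A2) ∈ Submonoid.closure {(toFG u)⁻¹, toFG v} := by
      intro l1 l2
      obtain ⟨x, rfl⟩ := List.length_eq_one_iff.1 l1
      obtain ⟨y, rfl⟩ := List.length_eq_one_iff.1 l2
      have hxy : x = 0 ∧ y = 1 := by
        clear * - hd
        revert x y; decide
      obtain ⟨rfl, rfl⟩ := hxy
      exact ⟨by simpa [toFG] using mu, by simpa [toFG] using mv⟩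
    rcases le_total u.length v.length with hl | hl
    · rcases hP.cases hl with ⟨w, hw⟩ | ⟨w, hw⟩ | ⟨l1, l2⟩
      · have e : toFG w = (toFG u)⁻¹ * toFG v := by rw [← hw, toFG_append]; group
        refine step u w mu (e ▸ Submonoid.mul_mem _ mu mv) ?_ ?_ ?_
        · rw [← hw] at hn; simp at hn; omega
        · rw [← hw] at h; exact gen_prefix h
        · rw [← hw] at hd; simp only [List.count_append, Nat.cast_add] at hd; linarith
      · have e : toFG w = toFG v * (toFG u)⁻¹ := by rw [← hw, toFG_append]; group
        refine step u w mu (e ▸ Submonoid.mul_mem _ mv mu) ?_ ?_ ?_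
        · rw [← hw] at hn; simp at hn; omega
        · rw [← hw] at h; exact gen_suffix h
        · rw [← hw] at hd; simp only [List.count_append, Nat.cast_add] at hd; linarith
      · exact hbase l1 l2
    · rcases hP.symm.cases hl with ⟨w, hw⟩ | ⟨w, hw⟩ | ⟨l1, l2⟩
      · have e : (toFG w)⁻¹ = (toFG u)⁻¹ * toFG v := by rw [← hw, toFG_append]; group
        refine step w v (e ▸ Submonoid.mul_mem _ mu mv) mv ?_ ?_ ?_
        · rw [← hw] at hn; simp at hn; omega
        · rw [← hw] at h; exact (gen_prefix h.symm).symm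
        · rw [← hw] at hd; simp only [List.count_append, Nat.cast_add] at hd; linarith
      · have e : (toFG w)⁻¹ = toFG v * (toFG u)⁻¹ := by rw [← hw, toFG_append]; group
        refine step w v (e ▸ Submonoid.mul_mem _ mv mu) mv ?_ ?_ ?_
        · rw [← hw] at hn; simp at hn; omega
        · rw [← hw] at h; exact (gen_suffix h.symm).symm
        · rw [← hw] at hd; simp only [List.count_append, Nat.cast_add] at hd; linarith
      · exact hbase l2 l1

lemma endo_of (σ : Subst) (i : A2) : endo σ (FreeGroup.of i) = toFG (σ i) :=
  FreeGroup.lift_apply_of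

lemma tau0 : tauA (FreeGroup.of 0) = (FreeGroup.of 0)⁻¹ := by
  unfold tauA
  exact FreeGroup.lift_apply_of.trans (by simp)

lemma tau1 : tauA (FreeGroup.of 1) = FreeGroup.of 1 := by
  unfold tauA
  exact FreeGroup.lift_apply_of.trans (by simp)

lemma word_of_mem (σ : Subst) {x : FreeGroup A2}
    (hx : x ∈ Submonoid.closure {(toFG (σ 0))⁻¹, toFG (σ 1)}) :
    ∃ w : List A2, endo σ (tauA (toFG w)) = x := by
  induction hx using Submonoid.closure_induction with
  | mem x hx =>
    rcases hx with rfl | rfl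
    · exact ⟨[0], by simp [toFG_cons, tau0, endo_of, show toFG [] = 1 from rfl]⟩
    · exact ⟨[1], by simp [toFG_cons, tau1, endo_of, show toFG [] = 1 from rfl]⟩
  | one => exact ⟨[], by simp [show toFG [] = 1 from rfl]⟩
  | mul x y _ _ h1 h2 =>
    obtain ⟨w1, rfl⟩ := h1
    obtain ⟨w2, rfl⟩ := h2
    exact ⟨w1 ++ w2, by simp [toFG_append]⟩

lemma tau_tau (x : FreeGroup A2) : tauA (tauA x) = x := by
  have : (tauA.comp tauA : FreeGroup A2 →* FreeGroup A2) = MonoidHom.id _ := by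
    apply FreeGroup.ext_hom
    intro i
    fin_cases i
    · change tauA (tauA (FreeGroup.of 0)) = FreeGroup.of 0
      rw [tau0, map_inv, tau0, inv_inv]
    · change tauA (tauA (FreeGroup.of 1)) = FreeGroup.of 1
      rw [tau1, tau1]
  exact DFunLike.congr_fun this x

/-- Additive exponent sum. -/
def ex (i : A2) (x : FreeGroup A2) : ℤ := Multiplicative.toAdd (expSum i x)

lemma ex_mul (i : A2) (x y : FreeGroup A2) : ex i (x * y) = ex i x + ex i y := by simp [ex]
lemma ex_inv (i : A2) (x : FreeGroup A2) : ex i x⁻¹ = - ex i x := by simp [ex]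
lemma ex_one (i : A2) : ex i 1 = 0 := by simp [ex]
lemma ex_of (i j : A2) : ex i (FreeGroup.of j) = if j = i then 1 else 0 := by simp [ex, expSum]
lemma ex_toFG (i : A2) (w : List A2) : ex i (toFG w) = w.count i := by
  induction w with
  | nil => simp [toFG, ex_one]
  | cons c w ih =>
    rw [toFG_cons, ex_mul, ih, ex_of, List.count_cons]
    by_cases h : c = i <;> simp [h, add_comm]

lemma ex_word (σ : Subst) (i : A2) (w : List A2) : ex i (endo σ (tauA (toFG w))) =
    - M σ i 0 * w.count 0 + M σ i 1 * w.count 1 := by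
  induction w with
  | nil => simp [toFG, ex_one]
  | cons c w ih =>
    rw [toFG_cons, map_mul, map_mul, ex_mul, ih]
    fin_cases c
    · simp only [Fin.zero_eta, tau0, map_inv, endo_of, ex_inv, ex_toFG, M]
      simp; ring
    · simp only [Fin.mk_one, tau1, endo_of, ex_toFG, M]
      simp; ring

end RecipAux

open TwoSubst in
/-- Let `σ` be an invertible substitution on `{a,b}` with
`det M_σ = +1`, with inverse automorphism `φ = σ⁻¹`. Then the reciprocal
`σ̄ = τ_a ∘ σ⁻¹ ∘ τ_a⁻¹` is again a (non-erasing) substitution `ρ` on `{a,b}`; its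
substitution matrix satisfies `M_{σ̄} = D · M_σ⁻¹ · D` with `D = [[−1,0],[0,1]]`, hence
`E · M_{σ̄} · E = M_σᵀ` with `E = [[0,1],[1,0]]`; and if `σ` is primitive then so
is `σ̄`. -/
theorem reciprocal_exists (σ : Subst) (hne : NonErasing σ) (hdet : (M σ).det = 1)
    (φ : Monoid.End (FreeGroup A2))
    (hl : ∀ x, φ (endo σ x) = x) (hr : ∀ x, endo σ (φ x) = x) :
    ∃ ρ : Subst, NonErasing ρ ∧ (∀ x, endo ρ x = tauA (φ (tauA x))) ∧
      M ρ = !![(-1 : ℤ), 0; 0, 1] * (M σ)⁻¹ * !![(-1 : ℤ), 0; 0, 1] ∧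
      !![(0 : ℤ), 1; 1, 0] * M ρ * !![(0 : ℤ), 1; 1, 0] = (M σ)ᵀ ∧
      (Primitive σ → Primitive ρ) := by
  have hg : RecipAux.Gen (σ 0) (σ 1) := by
    intro H h0 h1 x
    have : ∀ y, endo σ y ∈ H := by
      intro y
      induction y using FreeGroup.induction_on with
      | C1 => simpa using H.one_mem
      | of i =>
        change endo σ (FreeGroup.of i) ∈ H
        rw [RecipAux.endo_of]; fin_cases i
        · exact h0
        · exact h1
      | inv_of i hi => rw [map_inv]; exact H.inv_mem hi
      | mul x y hx hy => rw [map_mul]; exact H.mul_mem hx hy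
    rw [← hr x]; exact this _
  have hd := hdet
  rw [Matrix.det_fin_two] at hd
  obtain ⟨m0, m1⟩ := RecipAux.main_mem _ (σ 0) (σ 1) le_rfl hg (by simpa [M] using hd)
  obtain ⟨w0, hw0⟩ := RecipAux.word_of_mem σ m0
  obtain ⟨w1, hw1⟩ := RecipAux.word_of_mem σ m1
  have hf : ∀ w, φ (endo σ (tauA (toFG w))) = tauA (toFG w) := fun w => hl _
  have q00 := RecipAux.ex_word σ 0 w0
  have q10 := RecipAux.ex_word σ 1 w0
  have q01 := RecipAux.ex_word σ 0 w1
  have q11 := RecipAux.ex_word σ 1 w1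
  rw [hw0, RecipAux.ex_inv, RecipAux.ex_of] at q00 q10
  rw [hw1, RecipAux.ex_of] at q01 q11
  norm_num at q00 q10 q01 q11
  set A := M σ 0 0
  set B := M σ 0 1
  set C := M σ 1 0
  set D := M σ 1 1
  have r0 : (w0.count 0 : ℤ) = D := by linear_combination D * q00 - B * q10 - (w0.count 0 : ℤ) * hd
  have r1 : (w0.count 1 : ℤ) = C := by linear_combination C * q00 - A * q10 - (w0.count 1 : ℤ) * hd
  have r2 : (w1.count 0 : ℤ) = B := by linear_combination D * q01 - B * q11 - (w1.count 0 : ℤ) * hd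
  have r3 : (w1.count 1 : ℤ) = A := by linear_combination C * q01 - A * q11 - (w1.count 1 : ℤ) * hd
  have hMσ : M σ = !![A, B; C, D] := Matrix.eta_fin_two _
  have hMρ : M ![w0, w1] = !![D, B; C, A] := by
    rw [Matrix.eta_fin_two (M ![w0, w1])]
    simp only [M]
    simp [r0, r1, r2, r3]
  have hE : !![(0 : ℤ), 1; 1, 0] * M ![w0, w1] * !![(0 : ℤ), 1; 1, 0] = (M σ)ᵀ := by
    rw [hMρ, hMσ]
    ext i j
    fin_cases i <;> fin_cases j <;> simp [Matrix.mul_apply, Fin.sum_univ_two]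
  have hEE : !![(0 : ℤ), 1; 1, 0] * !![(0 : ℤ), 1; 1, 0] = 1 := by
    ext i j
    fin_cases i <;> fin_cases j <;> simp [Matrix.mul_apply, Fin.sum_univ_two]
  refine ⟨![w0, w1], ?_, ?_, ?_, hE, ?_⟩
  · intro i hi
    fin_cases i
    · have hi' : w0 = [] := hi
      subst hi'
      simp only [List.count_nil, Nat.cast_zero, mul_zero, add_zero] at q00
      omega
    · have hi' : w1 = [] := hi
      subst hi'
      simp only [List.count_nil, Nat.cast_zero, mul_zero, add_zero] at q11
      omega
  · intro x
    have : (endo ![w0, w1] : FreeGroup A2 →* FreeGroup A2) =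
        MonoidHom.comp tauA (MonoidHom.comp φ tauA) := by
      apply FreeGroup.ext_hom
      intro i
      fin_cases i
      · change endo ![w0, w1] (FreeGroup.of 0) = tauA (φ (tauA (FreeGroup.of 0)))
        rw [RecipAux.endo_of, RecipAux.tau0, ← hw0, hf, RecipAux.tau_tau]; rfl
      · change endo ![w0, w1] (FreeGroup.of 1) = tauA (φ (tauA (FreeGroup.of 1)))
        rw [RecipAux.endo_of, RecipAux.tau1, ← hw1, hf, RecipAux.tau_tau]; rfl
    exact DFunLike.congr_fun this x
  · rw [Matrix.inv_def, hdet, Ring.inverse_one, one_smul, hMρ, hMσ, Matrix.adjugate_fin_two]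
    ext i j
    fin_cases i <;> fin_cases j <;> simp [Matrix.mul_apply, Fin.sum_univ_two]
  · rintro ⟨n, hn, hpos⟩
    have hpow : ∀ n : ℕ, M ![w0, w1] ^ n =
        !![(0 : ℤ), 1; 1, 0] * (M σ ^ n)ᵀ * !![(0 : ℤ), 1; 1, 0] := by
      intro n
      induction n with
      | zero => simp [hEE]
      | succ n ih =>
        rw [pow_succ, ih, pow_succ', Matrix.transpose_mul, ← hE]
        simp only [Matrix.mul_assoc, hEE, Matrix.mul_one]
    refine ⟨n, hn, fun i j => ?_⟩
    rw [hpow]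
    generalize M σ ^ n = N at hpos
    rw [Matrix.eta_fin_two Nᵀ]
    fin_cases i <;> fin_cases j <;>
      simp [Matrix.mul_apply, Fin.sum_univ_two, hpos]
end
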